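/- For all integers k and m with m ≥ k ≥ 4, there exists a finite simple graph G such that mon-cr(G) ≤ C(2k,2) and pcr(G) ≥ m, where C(2k,2) = 2k(2k-1)/2. -/

import Mathlib

open Set

noncomputable section

abbrev Plane : Type := ℝ × ℝ

/-- The setoid on nonzero vectors of `ℝ³` identifying nonzero scalar multiples. -/
def projSetoid : Setoid {v : Fin 3 → ℝ // v ≠ 0} where
  r v w := ∃ c : ℝ, c ≠ 0 ∧ c • v.1 = w.1
  iseqv := by
    constructor
    · exact fun v => ⟨1, one_ne_zero, one_smul _ _⟩
    · rintro v w ⟨c, hc, h⟩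
      exact ⟨c⁻¹, inv_ne_zero hc, by rw [← h, smul_smul, inv_mul_cancel₀ hc, one_smul]⟩
    · rintro u v w ⟨c, hc, h⟩ ⟨d, hd, h'⟩
      exact ⟨d * c, mul_ne_zero hd hc, by rw [← h', ← h, smul_smul]⟩

/-- The real projective plane, as the quotient of `ℝ³ \ {0}` by nonzero scaling. -/
def RP2 : Type := Quotient projSetoid

instance : TopologicalSpace RP2 := instTopologicalSpaceQuotient

/-- The standard affine embedding of the plane in the projective plane. -/
def planeToRP2 (p : Plane) : RP2 :=
  Quotient.mk projSetoid ⟨![p.1, p.2, 1], by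
    intro h
    simpa using congrFun h 2⟩

/-- A pseudoline: a simple closed curve in the projective plane that does not
disconnect it. -/
def IsPseudoline (L : Set RP2) : Prop :=
  ∃ f : AddCircle (1 : ℝ) → RP2,
    Continuous f ∧ Function.Injective f ∧ Set.range f = L ∧ IsConnected Lᶜ

/-- A drawing of a graph in the plane: vertices are distinct points, each edge is a
simple arc (parametrized on `[0,1]`) joining its endpoints, and no arc passes
through a vertex other than its endpoints. -/
structure Drawing {V : Type*} (G : SimpleGraph V) where
  vert : V → Plane
  vert_inj : Function.Injective vert
  arc : G.edgeSet → ℝ → Plane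
  arc_cont : ∀ e, ContinuousOn (arc e) (Icc 0 1)
  arc_injOn : ∀ e, InjOn (arc e) (Icc 0 1)
  arc_ends : ∀ e : G.edgeSet, ∃ x y : V,
    (e : Sym2 V) = s(x, y) ∧ arc e 0 = vert x ∧ arc e 1 = vert y
  arc_avoid : ∀ (e : G.edgeSet) (t : ℝ), t ∈ Icc (0:ℝ) 1 →
    (∃ v, arc e t = vert v) → t = 0 ∨ t = 1

namespace Drawing

variable {V : Type*} {G : SimpleGraph V} (D : Drawing G)

/-- The interior (relative to its endpoints) of the arc of an edge. -/
def interOf (e : G.edgeSet) : Set Plane := D.arc e '' Ioo 0 1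

/-- The set of crossings of a drawing: pairs consisting of a point of the plane
together with an (unordered) pair of distinct edges whose interiors both pass
through the point. -/
def CrossSet : Set (Plane × Sym2 G.edgeSet) :=
  { x | ∃ e f : G.edgeSet, e ≠ f ∧ x.2 = s(e, f) ∧
      x.1 ∈ D.interOf e ∧ x.1 ∈ D.interOf f }

/-- The weighted number of crossings of a drawing: each crossing of a pair of
edges `e`, `f` contributes `w e * w f`. -/
def wcount (w : Sym2 V → ℕ) : ℕ :=
  ∑ᶠ x ∈ D.CrossSet,
    Sym2.lift ⟨fun e f : G.edgeSet => w e * w f, fun e f => mul_comm _ _⟩ x.2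

/-- A drawing is pseudolinear if each edge can be extended to a pseudoline of the
projective plane (via the standard affine embedding of the plane in the projective
plane) so that the extensions form a pseudoline arrangement: any two of the
pseudolines extending distinct edges meet in exactly one point. -/
def IsPseudolinear : Prop :=
  ∃ L : G.edgeSet → Set RP2,
    (∀ e, IsPseudoline (L e)) ∧
    (∀ e, ∀ t ∈ Icc (0:ℝ) 1, planeToRP2 (D.arc e t) ∈ L e) ∧
    (∀ e f, e ≠ f → ∃! p, p ∈ L e ∧ p ∈ L f)

/-- A drawing is rectilinear if every edge is drawn as a straight line segment. -/
def IsRectilinear : Prop :=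
  ∀ e, ∀ t ∈ Icc (0:ℝ) 1, D.arc e t = (1 - t) • D.arc e 0 + t • D.arc e 1

/-- A drawing is x-monotone if every edge meets every vertical line in at most one
point. -/
def IsMonotone : Prop :=
  ∀ e, InjOn (fun t => (D.arc e t).1) (Icc 0 1)

end Drawing

/-- The crossing number of `G` relative to a class of drawings `P`: the minimum
number of crossings in a drawing of `G` satisfying `P` (with finitely many
crossings). -/
def crNumP {V : Type*} (G : SimpleGraph V) (P : Drawing G → Prop) : ℕ :=
  sInf { n | ∃ D : Drawing G, P D ∧ D.CrossSet.Finite ∧ D.CrossSet.ncard = n }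

/-- The crossing number `cr G`. -/
def crNum {V : Type*} (G : SimpleGraph V) : ℕ := crNumP G fun _ => True

/-- The pseudolinear crossing number `pcr G`. -/
def pcrNum {V : Type*} (G : SimpleGraph V) : ℕ := crNumP G Drawing.IsPseudolinear

/-- The rectilinear crossing number `rcr G`. -/
def rcrNum {V : Type*} (G : SimpleGraph V) : ℕ := crNumP G Drawing.IsRectilinear

/-- The monotone crossing number `mon-cr G`. -/
def moncrNum {V : Type*} (G : SimpleGraph V) : ℕ := crNumP G Drawing.IsMonotone

/-- The weighted crossing number of `(G, w)` relative to a class of drawings. -/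
def wcrNumP {V : Type*} (G : SimpleGraph V) (w : Sym2 V → ℕ) (P : Drawing G → Prop) : ℕ :=
  sInf { n | ∃ D : Drawing G, P D ∧ D.CrossSet.Finite ∧ D.wcount w = n }

/-- The weighted crossing number `cr (G, w)`. -/
def wcrNum {V : Type*} (G : SimpleGraph V) (w : Sym2 V → ℕ) : ℕ :=
  wcrNumP G w fun _ => True

/-- The weighted pseudolinear crossing number `pcr (G, w)`. -/
def wpcrNum {V : Type*} (G : SimpleGraph V) (w : Sym2 V → ℕ) : ℕ :=
  wcrNumP G w Drawing.IsPseudolinear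

/-- The weighted rectilinear crossing number `rcr (G, w)`. -/
def wrcrNum {V : Type*} (G : SimpleGraph V) (w : Sym2 V → ℕ) : ℕ :=
  wcrNumP G w Drawing.IsRectilinear

open unitInterval

/-- A nowhere vanishing function on `ℝ × ℝ` has a continuous logarithm. -/
theorem exists_continuous_log_plane (F : C(ℝ × ℝ, ℂ)) (hF : ∀ x, F x ≠ 0) :
    ∃ g : C(ℝ × ℝ, ℂ), ∀ x, Complex.exp (2 * Real.pi * Complex.I * g x) = F x := by
  obtain ⟨g, ⟨-, hg⟩, -⟩ := Complex.isCoveringMapOn_exp.existsUnique_continuousMap_lifts F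
    (a₀ := (0, 0)) (Complex.exp_log (hF (0, 0))) (fun x => by simpa using hF x)
  refine ⟨⟨fun x => g x / (2 * Real.pi * Complex.I), by fun_prop⟩, fun x => ?_⟩
  have h2 := congrFun hg x
  simp only [Function.comp_apply] at h2
  rw [← h2, ContinuousMap.coe_mk, mul_div_cancel₀ _ Complex.two_pi_I_ne_zero]

open unitInterval in
theorem exists_continuous_log_square (F : C(I × I, ℂ)) (hF : ∀ x, F x ≠ 0) :
    ∃ g : C(I × I, ℂ), ∀ x, Complex.exp (2 * Real.pi * Complex.I * g x) = F x := by
  obtain ⟨g, hg⟩ := exists_continuous_log_plane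
    ⟨fun x => F (projIcc 0 1 zero_le_one x.1, projIcc 0 1 zero_le_one x.2), by fun_prop⟩
    (fun x => hF _)
  refine ⟨⟨fun x => g (x.1, x.2), by fun_prop⟩, fun x => ?_⟩
  simpa using hg (x.1, x.2)

open unitInterval in
theorem exists_continuous_log_interval (F : C(I, ℂ)) (hF : ∀ x, F x ≠ 0) :
    ∃ g : C(I, ℂ), ∀ x, Complex.exp (2 * Real.pi * Complex.I * g x) = F x := by
  obtain ⟨g, hg⟩ := exists_continuous_log_square
    ⟨fun x => F x.1, by fun_prop⟩ (fun x => hF _)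
  exact ⟨⟨fun x => g (x, 0), by fun_prop⟩, fun x => hg (x, 0)⟩

theorem exp_two_pi_eq_iff {x y : ℂ} :
    Complex.exp (2 * Real.pi * Complex.I * x) = Complex.exp (2 * Real.pi * Complex.I * y) ↔
      ∃ n : ℤ, x = y + n := by
  rw [Complex.exp_eq_exp_iff_exists_int]
  have : (2 * Real.pi * Complex.I : ℂ) ≠ 0 := Complex.two_pi_I_ne_zero
  refine exists_congr fun n => ⟨fun h => mul_left_cancel₀ this ?_, fun h => ?_⟩
  · rw [h]; ring
  · rw [h]; ring

theorem exp_two_pi_add_half (x : ℂ) :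
    Complex.exp (2 * Real.pi * Complex.I * (x + 1 / 2)) =
      -Complex.exp (2 * Real.pi * Complex.I * x) := by
  rw [show 2 * Real.pi * Complex.I * (x + 1 / 2) =
    2 * Real.pi * Complex.I * x + Real.pi * Complex.I by ring, Complex.exp_add,
    Complex.exp_pi_mul_I]
  ring

open unitInterval

open Classical in
/-- The increment along `f` of the logarithm of `f - w`, in units of `2πi`; for a closed curve
this is the winding number around `w`. -/
def logInc (f : C(I, ℂ)) (w : ℂ) : ℂ :=
  if h : ∀ t, f t - w ≠ 0 then
    (exists_continuous_log_interval ⟨fun t => f t - w, by fun_prop⟩ h).choose 1 -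
    (exists_continuous_log_interval ⟨fun t => f t - w, by fun_prop⟩ h).choose 0
  else 0

theorem logInc_eq {f : C(I, ℂ)} {w : ℂ} (g : I → ℂ) (hg : Continuous g)
    (h : ∀ t, Complex.exp (2 * Real.pi * Complex.I * g t) = f t - w) :
    logInc f w = g 1 - g 0 := by
  have h0 : ∀ t, f t - w ≠ 0 := fun t => h t ▸ Complex.exp_ne_zero _
  rw [logInc, dif_pos h0]
  set k := (exists_continuous_log_interval ⟨fun t => f t - w, by fun_prop⟩ h0).choose with hk
  have hks : ∀ t, Complex.exp (2 * Real.pi * Complex.I * k t) = f t - w :=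
    (exists_continuous_log_interval ⟨fun t => f t - w, by fun_prop⟩ h0).choose_spec
  have hn : ∀ t, ∃ n : ℤ, k t - g t = n := fun t => by
    obtain ⟨n, hn⟩ := exp_two_pi_eq_iff.1 ((hks t).trans (h t).symm)
    exact ⟨n, by rw [hn]; ring⟩
  choose n hn using hn
  have hcn : Continuous n := by
    have : Continuous fun t => ((n t : ℤ) : ℂ) := by
      simp_rw [← hn]; fun_prop
    exact (Int.isClosedEmbedding_coe_real.isEmbedding.continuous_iff).2
      (by simpa [Function.comp_def] using Complex.continuous_re.comp this)
  have hc := PreconnectedSpace.constant inferInstance hcn (x := 1) (y := 0)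
  have h1 := hn 1
  have h2 := hn 0
  rw [hc] at h1
  linear_combination h1 - h2

theorem exists_logInc_branch {f : C(I, ℂ)} {w : ℂ} (h : w ∉ range f) :
    ∃ g : C(I, ℂ), ∀ t, Complex.exp (2 * Real.pi * Complex.I * g t) = f t - w :=
  exists_continuous_log_interval ⟨fun t => f t - w, by fun_prop⟩
    fun t ht => h ⟨t, sub_eq_zero.1 ht⟩

theorem logInc_int {f : C(I, ℂ)} {w x y : ℂ} (h : w ∉ range f)
    (hx : Complex.exp (2 * Real.pi * Complex.I * x) = f 1 - w)
    (hy : Complex.exp (2 * Real.pi * Complex.I * y) = f 0 - w) :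
    ∃ n : ℤ, logInc f w = x - y + n := by
  obtain ⟨g, hg⟩ := exists_logInc_branch h
  rw [logInc_eq g g.continuous hg]
  obtain ⟨n, hn⟩ := exp_two_pi_eq_iff.1 ((hg 1).trans hx.symm)
  obtain ⟨m, hm⟩ := exp_two_pi_eq_iff.1 ((hg 0).trans hy.symm)
  exact ⟨n - m, by rw [hn, hm]; push_cast; ring⟩

theorem logInc_trans {a b c : ℂ} (p : Path a b) (q : Path b c) {w : ℂ}
    (hp : w ∉ range p) (hq : w ∉ range q) :
    logInc (p.trans q).toContinuousMap w =
      logInc p.toContinuousMap w + logInc q.toContinuousMap w := by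
  obtain ⟨g, hg⟩ := exists_logInc_branch (f := p.toContinuousMap) hp
  obtain ⟨k, hk⟩ := exists_logInc_branch (f := q.toContinuousMap) hq
  let g' : Path (g 0) (g 1) := ⟨g, rfl, rfl⟩
  let k' : Path (g 1) (k 1 - k 0 + g 1) :=
    ⟨⟨fun t => k t - k 0 + g 1, by fun_prop⟩, by simp, rfl⟩
  rw [logInc_eq g g.continuous hg, logInc_eq k k.continuous hk,
    logInc_eq (g'.trans k') (g'.trans k').continuous]
  · simp only [Path.target, Path.source]; ring
  · intro t
    simp only [Path.coe_toContinuousMap, Path.trans_apply]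
    split_ifs with ht
    · exact hg _
    · have e1 := hg 1
      have e2 := hk 0
      simp only [Path.coe_toContinuousMap, Path.target, Path.source] at e1 e2
      obtain ⟨n, hn⟩ := exp_two_pi_eq_iff.1 (e2.trans e1.symm)
      refine Eq.trans (exp_two_pi_eq_iff.2 ⟨-n, ?_⟩) (hk _)
      change k _ - k 0 + g 1 = _
      rw [hn]; push_cast; ring

theorem logInc_symm {a b : ℂ} (p : Path a b) {w : ℂ} (hp : w ∉ range p) :
    logInc p.symm.toContinuousMap w = -logInc p.toContinuousMap w := by
  obtain ⟨g, hg⟩ := exists_logInc_branch (f := p.toContinuousMap) hp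
  rw [logInc_eq g g.continuous hg, logInc_eq (fun t => g (σ t)) (by fun_prop)]
  · simp
  · intro t; exact hg (σ t)

/-- The algebraic intersection number of two curves, neither of which contains an endpoint
of the other. -/
def interNum (f h : C(I, ℂ)) : ℂ :=
  logInc f (h 0) - logInc f (h 1) + logInc h (f 1) - logInc h (f 0)

theorem interNum_eq_zero {f h : C(I, ℂ)} (hd : Disjoint (range f) (range h)) :
    interNum f h = 0 := by
  obtain ⟨g, hg⟩ := exists_continuous_log_square ⟨fun x => f x.1 - h x.2, by fun_prop⟩
    (fun x hx => (disjoint_left.1 hd ⟨x.1, rfl⟩) ⟨x.2, (sub_eq_zero.1 hx).symm⟩)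
  simp only [ContinuousMap.coe_mk] at hg
  rw [interNum, logInc_eq (f := f) (w := h 0) (fun t => g (t, 0)) (by fun_prop) fun t => hg _,
    logInc_eq (f := f) (w := h 1) (fun t => g (t, 1)) (by fun_prop) fun t => hg _,
    logInc_eq (f := h) (w := f 1) (fun t => g (1, t) + 1 / 2) (by fun_prop)
      fun t => by rw [exp_two_pi_add_half, hg]; ring,
    logInc_eq (f := h) (w := f 0) (fun t => g (0, t) + 1 / 2) (by fun_prop)
      fun t => by rw [exp_two_pi_add_half, hg]; ring]
  ring

theorem interNum_closed {f h : C(I, ℂ)} (hf : f 0 = f 1) :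
    interNum f h = logInc f (h 0) - logInc f (h 1) := by
  rw [interNum, hf]; ring

/-- Winding numbers around points joined by a curve avoiding the closed curve agree. -/
theorem logInc_eq_of_disjoint {f h : C(I, ℂ)} (hf : f 0 = f 1)
    (hd : Disjoint (range f) (range h)) : logInc f (h 0) = logInc f (h 1) :=
  sub_eq_zero.1 (by rw [← interNum_closed hf, interNum_eq_zero hd])

/-- A closed curve inside an open half-plane has winding number zero around the points of
the boundary line. -/
theorem logInc_eq_zero_of_halfPlane {f : C(I, ℂ)} (hf : f 0 = f 1) {w u : ℂ}
    (h : ∀ t, 0 < ((f t - w) * u).re) : logInc f w = 0 := by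
  have hu : u ≠ 0 := by
    rintro rfl
    simpa using h 0
  have hpi : (2 * Real.pi * Complex.I : ℂ) ≠ 0 := Complex.two_pi_I_ne_zero
  rw [logInc_eq (fun t => (Complex.log ((f t - w) * u) - Complex.log u) /
    (2 * Real.pi * Complex.I))]
  · simp [hf]
  · refine Continuous.div_const (Continuous.sub (Continuous.clog (by fun_prop) ?_) (by fun_prop)) _
    exact fun t => Complex.mem_slitPlane_iff.2 (Or.inl (h t))
  · intro t
    rw [mul_div_cancel₀ _ hpi, Complex.exp_sub, Complex.exp_log, Complex.exp_log hu]
    · field_simp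
    · intro h0
      simpa [h0] using h t

/-- The winding number of a closed curve is zero around points far away. -/
theorem logInc_eq_zero_of_norm_le {l : C(I, ℂ)} {q : ℂ} (hl : l 0 = l 1) (hq : q ∉ range l)
    (hle : ∀ t, ‖l t‖ ≤ ‖q‖) : logInc l q = 0 := by
  refine logInc_eq_zero_of_halfPlane hl (u := -(starRingEnd ℂ q)) fun t => ?_
  have hne : l t - q ≠ 0 := fun h => hq ⟨t, sub_eq_zero.1 h⟩
  have h1 : 0 < Complex.normSq (l t - q) := Complex.normSq_pos.2 hne
  have h2 : Complex.normSq (l t) ≤ Complex.normSq q := by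
    rw [Complex.normSq_eq_norm_sq, Complex.normSq_eq_norm_sq]
    gcongr; exact hle t
  simp only [Complex.normSq_apply, Complex.sub_re, Complex.sub_im, Complex.mul_re,
    Complex.neg_re, Complex.neg_im, Complex.conj_re, Complex.conj_im] at h1 h2 ⊢
  nlinarith

/-- Two disjoint closed curves cannot both wind around each other. -/
theorem logInc_extremal {f h : C(I, ℂ)} (hf : f 0 = f 1) (hh : h 0 = h 1)
    (hd : Disjoint (range f) (range h)) (hw : logInc f (h 0) ≠ 0) :
    logInc h (f 0) = 0 := by
  obtain ⟨s, -, hs⟩ := isCompact_univ.exists_isMaxOn univ_nonempty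
    (f := fun t => ‖f t‖) (by fun_prop)
  obtain ⟨s', -, hs'⟩ := isCompact_univ.exists_isMaxOn univ_nonempty
    (f := fun t => ‖h t‖) (by fun_prop)
  have sub : ∀ (k : C(I, ℂ)) (t : I), ∃ k' : C(I, ℂ), k' 0 = k 0 ∧ k' 1 = k t ∧
      range k' ⊆ range k := fun k t =>
    ⟨⟨fun x => k (x * t), by fun_prop⟩, by simp, by simp, by rintro _ ⟨x, rfl⟩; exact ⟨_, rfl⟩⟩
  rcases le_total ‖h s'‖ ‖f s‖ with hle | hle
  · obtain ⟨k, hk0, hk1, hk⟩ := sub f s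
    rw [← hk0, logInc_eq_of_disjoint hh (hd.symm.mono_right hk), hk1]
    exact logInc_eq_zero_of_norm_le hh (fun hx => disjoint_left.1 hd ⟨s, rfl⟩ hx)
      fun t => (hs' (mem_univ t)).trans hle
  · obtain ⟨k, hk0, hk1, hk⟩ := sub h s'
    refine absurd ?_ hw
    rw [← hk0, logInc_eq_of_disjoint hf (hd.mono_right hk), hk1]
    exact logInc_eq_zero_of_norm_le hf (fun hx => disjoint_left.1 hd hx ⟨s', rfl⟩)
      fun t => (hs (mem_univ t)).trans hle

/-- The increment of the normalized logarithm around `w` along a path. -/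
def Path.wind {a b : ℂ} (p : Path a b) (w : ℂ) : ℂ := logInc p.toContinuousMap w

/-- The algebraic intersection number of two paths. -/
def Path.inter {a b c d : ℂ} (p : Path a b) (q : Path c d) : ℂ :=
  p.wind c - p.wind d + q.wind b - q.wind a

namespace Path

theorem inter_eq_interNum {a b c d : ℂ} (p : Path a b) (q : Path c d) :
    p.inter q = interNum p.toContinuousMap q.toContinuousMap := by
  simp [inter, interNum, wind]

variable {a b c d e f w : ℂ}

theorem wind_trans (p : Path a b) (q : Path b c) (hp : w ∉ range p) (hq : w ∉ range q) :
    (p.trans q).wind w = p.wind w + q.wind w := logInc_trans p q hp hq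

theorem wind_symm (p : Path a b) (hp : w ∉ range p) : p.symm.wind w = -p.wind w :=
  logInc_symm p hp

theorem inter_comm (p : Path a b) (q : Path c d) : q.inter p = -p.inter q := by
  simp only [inter]; ring

theorem inter_eq_zero {p : Path a b} {q : Path c d} (h : Disjoint (range p) (range q)) :
    p.inter q = 0 := by
  rw [inter_eq_interNum]; exact interNum_eq_zero h

theorem inter_trans_left (p : Path a b) (q : Path b c) (h : Path e f)
    (hp0 : e ∉ range p) (hp1 : f ∉ range p) (hq0 : e ∉ range q) (hq1 : f ∉ range q) :
    (p.trans q).inter h = p.inter h + q.inter h := by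
  simp only [inter, wind_trans p q hp0 hq0, wind_trans p q hp1 hq1]
  ring

theorem inter_trans_right (p : Path a b) (q : Path b c) (h : Path e f)
    (hp0 : e ∉ range p) (hp1 : f ∉ range p) (hq0 : e ∉ range q) (hq1 : f ∉ range q) :
    h.inter (p.trans q) = h.inter p + h.inter q := by
  rw [inter_comm, inter_trans_left p q h hp0 hp1 hq0 hq1, inter_comm h p, inter_comm h q]
  ring

theorem inter_symm_left (p : Path a b) (q : Path c d) (hc : c ∉ range p) (hd : d ∉ range p) :
    p.symm.inter q = -p.inter q := by
  simp only [inter, wind_symm p hc, wind_symm p hd]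
  ring

theorem inter_symm_right (p : Path a b) (q : Path c d) (hc : c ∉ range p) (hd : d ∉ range p) :
    q.inter p.symm = -q.inter p := by
  rw [inter_comm, inter_symm_left p q hc hd, inter_comm q p, neg_neg]

theorem inter_closed (p : Path a a) (q : Path c d) : p.inter q = p.wind c - p.wind d := by
  simp only [inter]; ring

/-- Winding numbers around points joined by a path avoiding the closed path agree. -/
theorem wind_eq_of_disjoint (p : Path a a) (q : Path c d) (h : Disjoint (range p) (range q)) :
    p.wind c = p.wind d :=
  sub_eq_zero.1 (by rw [← inter_closed, inter_eq_zero h])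

theorem wind_int {x y : ℂ} (p : Path a b) (h : w ∉ range p)
    (hx : Complex.exp (2 * Real.pi * Complex.I * x) = b - w)
    (hy : Complex.exp (2 * Real.pi * Complex.I * y) = a - w) :
    ∃ n : ℤ, p.wind w = x - y + n :=
  logInc_int (f := p.toContinuousMap) h (by simpa using hx) (by simpa using hy)

theorem wind_extremal {p : Path a a} {q : Path b b} (h : Disjoint (range p) (range q))
    (hw : p.wind b ≠ 0) : q.wind a = 0 := by
  have := logInc_extremal (f := p.toContinuousMap) (h := q.toContinuousMap)
    (by simp) (by simp) h (by simpa [wind] using hw)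
  simpa [wind] using this

end Path

/-- Distinct complex numbers have a normalized logarithm of their difference. -/
theorem exists_exp_two_pi_eq {z : ℂ} (hz : z ≠ 0) :
    ∃ x : ℂ, Complex.exp (2 * Real.pi * Complex.I * x) = z :=
  ⟨Complex.log z / (2 * Real.pi * Complex.I), by
    rw [mul_div_cancel₀ _ Complex.two_pi_I_ne_zero, Complex.exp_log hz]⟩

/-- An antisymmetric system of normalized logarithms of differences of three points. -/
theorem exists_log_system {A : Fin 3 → ℂ} (hA : Function.Injective A) :
    ∃ L : Fin 3 → Fin 3 → ℂ,
      (∀ i j, i ≠ j → Complex.exp (2 * Real.pi * Complex.I * L i j) = A i - A j) ∧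
      ∀ i j, i < j → L j i = L i j + 1 / 2 := by
  have h : ∀ i j, ∃ x, i ≠ j → Complex.exp (2 * Real.pi * Complex.I * x) = A i - A j := by
    intro i j
    by_cases hij : i = j
    · exact ⟨0, fun h => absurd hij h⟩
    · obtain ⟨x, hx⟩ := exists_exp_two_pi_eq (sub_ne_zero.2 (hA.ne hij))
      exact ⟨x, fun _ => hx⟩
  choose L hL using h
  refine ⟨fun i j => if i < j then L i j else L j i + 1 / 2, fun i j hij => ?_, fun i j hij => ?_⟩
  · by_cases h : i < j
    · simp only [h, if_true]; exact hL i j hij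
    · simp only [h, if_false]
      rw [exp_two_pi_add_half, hL j i hij.symm]; ring
  · simp only [hij, if_true, hij.asymm, if_false]

/-- Algebraic form of the nonplanarity of `K₃,₃`: in every drawing the total intersection number
of independent edges is odd. -/
theorem inter_K33 {A B : Fin 3 → ℂ} (F : ∀ i j, Path (A i) (B j))
    (hA : Function.Injective A) (hB : Function.Injective B) (hAB : ∀ i j, A i ≠ B j)
    (hFA : ∀ i j k, k ≠ i → A k ∉ range (F i j)) (hFB : ∀ i j l, l ≠ j → B l ∉ range (F i j)) :
    ∃ n : ℤ, ((F 0 0).inter (F 1 1) + (F 0 0).inter (F 1 2) + (F 0 1).inter (F 1 0) +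
        (F 0 1).inter (F 1 2) + (F 0 2).inter (F 1 0) + (F 0 2).inter (F 1 1)) +
      ((F 0 0).inter (F 2 1) + (F 0 0).inter (F 2 2) + (F 0 1).inter (F 2 0) +
        (F 0 1).inter (F 2 2) + (F 0 2).inter (F 2 0) + (F 0 2).inter (F 2 1)) +
      ((F 1 0).inter (F 2 1) + (F 1 0).inter (F 2 2) + (F 1 1).inter (F 2 0) +
        (F 1 1).inter (F 2 2) + (F 1 2).inter (F 2 0) + (F 1 2).inter (F 2 1)) = 2 * n + 1 := by
  obtain ⟨LA, hLA, hLA'⟩ := exists_log_system hA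
  obtain ⟨LB, hLB, hLB'⟩ := exists_log_system hB
  choose LC hLC using fun i j => exists_exp_two_pi_eq (sub_ne_zero.2 (hAB i j).symm)
  have hn : ∀ i j k, ∃ n : ℤ, k ≠ i → (F i j).wind (A k) = LC k j - LA i k + n := fun i j k => by
    by_cases h : k = i
    · exact ⟨0, fun h' => absurd h h'⟩
    · obtain ⟨n, hn⟩ := (F i j).wind_int (hFA i j k h) (hLC k j) (hLA i k (Ne.symm h))
      exact ⟨n, fun _ => hn⟩
  have hn' : ∀ i j l, ∃ n : ℤ, l ≠ j → (F i j).wind (B l) = LB j l - (LC i l + 1 / 2) + n :=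
    fun i j l => by
      by_cases h : l = j
      · exact ⟨0, fun h' => absurd h h'⟩
      · obtain ⟨n, hn⟩ := (F i j).wind_int (hFB i j l h) (hLB j l (Ne.symm h))
          (y := LC i l + 1 / 2) (by rw [exp_two_pi_add_half, hLC]; ring)
        exact ⟨n, fun _ => hn⟩
  choose n hn using hn
  choose n' hn' using hn'
  have key : ∀ i j k l, i < k → j < l → (F i j).inter (F k l) + (F i l).inter (F k j) =
      ((n i j k - n' i j l + n' k l j - n k l i + n i l k - n' i l j + n' k j l - n k j i + 1 :
        ℤ) : ℂ) := by
    intro i j k l hik hjl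
    simp only [Path.inter]
    rw [hn i j k hik.ne', hn' i j l hjl.ne', hn' k l j hjl.ne, hn k l i hik.ne,
      hn i l k hik.ne', hn' i l j hjl.ne, hn' k j l hjl.ne', hn k j i hik.ne, hLA' i k hik,
      hLB' j l hjl]
    push_cast; ring
  have h01 : (0 : Fin 3) < 1 := by decide
  have h02 : (0 : Fin 3) < 2 := by decide
  have h12 : (1 : Fin 3) < 2 := by decide
  let Z : Fin 3 → Fin 3 → Fin 3 → Fin 3 → ℤ := fun i j k l =>
    n i j k - n' i j l + n' k l j - n k l i + n i l k - n' i l j + n' k j l - n k j i + 1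
  obtain ⟨N, hN⟩ : Odd ((Z 0 0 1 1 + Z 0 0 1 2 + Z 0 1 1 2) +
      (Z 0 0 2 1 + Z 0 0 2 2 + Z 0 1 2 2) + (Z 1 0 2 1 + Z 1 0 2 2 + Z 1 1 2 2)) := by
    rw [Int.odd_iff]
    simp only [Z]
    omega
  refine ⟨N, ?_⟩
  have e : ∀ i k, i < k → (F i 0).inter (F k 1) + (F i 0).inter (F k 2) + (F i 1).inter (F k 0) +
      (F i 1).inter (F k 2) + (F i 2).inter (F k 0) + (F i 2).inter (F k 1) =
      Z i 0 k 1 + Z i 0 k 2 + Z i 1 k 2 := fun i k h => by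
    rw [← key i 0 k 1 h h01, ← key i 0 k 2 h h02, ← key i 1 k 2 h h12]; ring
  rw [e 0 1 h01, e 0 2 h02, e 1 2 h12]
  exact_mod_cast hN

namespace Path

theorem inter_int {a b c d : ℂ} (p : Path a b) (q : Path c d) (ha : a ∉ range q)
    (hb : b ∉ range q) (hc : c ∉ range p) (hd : d ∉ range p) :
    ∃ n : ℤ, p.inter q = n := by
  have nac : a - c ≠ 0 := fun h => hc ⟨0, by rw [p.source]; exact sub_eq_zero.1 h⟩
  have nad : a - d ≠ 0 := fun h => hd ⟨0, by rw [p.source]; exact sub_eq_zero.1 h⟩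
  have nbc : b - c ≠ 0 := fun h => hc ⟨1, by rw [p.target]; exact sub_eq_zero.1 h⟩
  have nbd : b - d ≠ 0 := fun h => hd ⟨1, by rw [p.target]; exact sub_eq_zero.1 h⟩
  obtain ⟨x, hx⟩ := exists_exp_two_pi_eq nac
  obtain ⟨y, hy⟩ := exists_exp_two_pi_eq nad
  obtain ⟨z, hz⟩ := exists_exp_two_pi_eq nbc
  obtain ⟨t, ht⟩ := exists_exp_two_pi_eq nbd
  have half : ∀ {u v w : ℂ}, Complex.exp (2 * Real.pi * Complex.I * u) = v - w →
      Complex.exp (2 * Real.pi * Complex.I * (u + 1 / 2)) = w - v := fun h => by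
    rw [exp_two_pi_add_half, h]; ring
  obtain ⟨n1, h1⟩ := p.wind_int hc hz hx
  obtain ⟨n2, h2⟩ := p.wind_int hd ht hy
  obtain ⟨n3, h3⟩ := q.wind_int hb (half ht) (half hz)
  obtain ⟨n4, h4⟩ := q.wind_int ha (half hy) (half hx)
  exact ⟨n1 - n2 + n3 - n4, by rw [inter, h1, h2, h3, h4]; push_cast; ring⟩

end Path

/-- If every pair of independent edges of a drawing of `K₃,₃` minus the edge `rs` has zero
intersection number, then the cycle on the remaining vertices separates `r` from `s`. -/
theorem odd_wind_sub_wind {a₁ a₂ b₁ b₂ r s : ℂ} {p₁₁ : Path a₁ b₁} {p₁₂ : Path a₁ b₂}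
    {p₂₁ : Path a₂ b₁} {p₂₂ : Path a₂ b₂} {r₁ : Path r b₁} {r₂ : Path r b₂}
    {s₁ : Path a₁ s} {s₂ : Path a₂ s}
    (h₁₁ : ∀ z ∈ ({a₂, b₂, r, s} : Set ℂ), z ∉ range p₁₁)
    (h₁₂ : ∀ z ∈ ({a₂, b₁, r, s} : Set ℂ), z ∉ range p₁₂)
    (h₂₁ : ∀ z ∈ ({a₁, b₂, r, s} : Set ℂ), z ∉ range p₂₁)
    (h₂₂ : ∀ z ∈ ({a₁, b₁, r, s} : Set ℂ), z ∉ range p₂₂)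
    (hr₁ : ∀ z ∈ ({a₁, a₂, b₂, s} : Set ℂ), z ∉ range r₁)
    (hr₂ : ∀ z ∈ ({a₁, a₂, b₁, s} : Set ℂ), z ∉ range r₂)
    (hs₁ : ∀ z ∈ ({a₂, b₁, b₂, r} : Set ℂ), z ∉ range s₁)
    (hs₂ : ∀ z ∈ ({a₁, b₁, b₂, r} : Set ℂ), z ∉ range s₂)
    (i₁ : p₁₁.inter p₂₂ = 0) (i₂ : p₁₂.inter p₂₁ = 0)
    (i₃ : p₁₁.inter s₂ = 0) (i₄ : p₁₂.inter s₂ = 0)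
    (i₅ : s₁.inter p₂₁ = 0) (i₆ : s₁.inter p₂₂ = 0)
    (i₇ : p₁₁.inter r₂ = 0) (i₈ : p₁₂.inter r₁ = 0)
    (i₉ : p₂₁.inter r₂ = 0) (i₁₀ : p₂₂.inter r₁ = 0)
    (i₁₁ : s₁.inter r₁ = 0) (i₁₂ : s₁.inter r₂ = 0)
    (i₁₃ : s₂.inter r₁ = 0) (i₁₄ : s₂.inter r₂ = 0) :
    ∃ n : ℤ, (p₁₁.wind r - p₂₁.wind r + p₂₂.wind r - p₁₂.wind r) -
      (p₁₁.wind s - p₂₁.wind s + p₂₂.wind s - p₁₂.wind s) = 2 * n + 1 := by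
  have src : ∀ {x y z : ℂ} (p : Path x y), z ∉ range p → x ≠ z := fun p h e =>
    h ⟨0, by rw [p.source, e]⟩
  have tgt : ∀ {x y z : ℂ} (p : Path x y), z ∉ range p → y ≠ z := fun p h e =>
    h ⟨1, by rw [p.target, e]⟩
  simp only [mem_insert_iff, mem_singleton_iff, forall_eq_or_imp, forall_eq] at *
  obtain ⟨δ, hδ⟩ : ∃ δ : Path r s, ∀ z ∈ ({a₁, a₂, b₁, b₂} : Set ℂ), z ∉ range δ := by
    have hc : IsPathConnected ({a₁, a₂, b₁, b₂} : Set ℂ)ᶜ :=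
      (Set.toFinite _).countable.isPathConnected_compl_of_one_lt_rank (by
        rw [Complex.rank_real_complex]; exact Nat.one_lt_ofNat)
    have hr : r ∈ ({a₁, a₂, b₁, b₂} : Set ℂ)ᶜ := by
      simp only [mem_compl_iff, mem_insert_iff, mem_singleton_iff, not_or]
      exact ⟨src r₁ hr₁.1, src r₁ hr₁.2.1, src r₂ hr₂.2.2.1, src r₁ hr₁.2.2.1⟩
    have hs : s ∈ ({a₁, a₂, b₁, b₂} : Set ℂ)ᶜ := by
      simp only [mem_compl_iff, mem_insert_iff, mem_singleton_iff, not_or]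
      exact ⟨tgt s₂ hs₂.1, tgt s₁ hs₁.1, tgt s₁ hs₁.2.1, tgt s₁ hs₁.2.2.1⟩
    obtain ⟨δ, h⟩ := hc.joinedIn r hr s hs
    exact ⟨δ, fun z hz ⟨t, ht⟩ => h t (ht ▸ hz)⟩
  simp only [mem_insert_iff, mem_singleton_iff, forall_eq_or_imp, forall_eq] at hδ
  let A : Fin 3 → ℂ := ![a₁, a₂, r]
  let B : Fin 3 → ℂ := ![b₁, b₂, s]
  let F : ∀ i j, Path (A i) (B j) := fun i j => match i, j with
    | 0, 0 => p₁₁ | 0, 1 => p₁₂ | 0, 2 => s₁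
    | 1, 0 => p₂₁ | 1, 1 => p₂₂ | 1, 2 => s₂
    | 2, 0 => r₁ | 2, 1 => r₂ | 2, 2 => δ
  obtain ⟨n, hn⟩ := inter_K33 F
    (by
      have e1 := src p₁₁ h₁₁.1
      have e2 := src p₁₁ h₁₁.2.2.1
      have e3 := src p₂₁ h₂₁.2.2.1
      intro i j; fin_cases i <;> fin_cases j <;> simp [A, e1, e2, e3, e1.symm, e2.symm, e3.symm])
    (by
      have e1 := tgt p₁₁ h₁₁.2.1
      have e2 := tgt p₁₁ h₁₁.2.2.2
      have e3 := tgt p₁₂ h₁₂.2.2.2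
      intro i j; fin_cases i <;> fin_cases j <;> simp [B, e1, e2, e3, e1.symm, e2.symm, e3.symm])
    (by
      intro i j; fin_cases i <;> fin_cases j
      exacts [src p₁₂ h₁₂.2.1, src p₁₁ h₁₁.2.1, src p₁₁ h₁₁.2.2.2, src p₂₂ h₂₂.2.1,
        src p₂₁ h₂₁.2.1, src p₂₁ h₂₁.2.2.2, src r₂ hr₂.2.2.1, src r₁ hr₁.2.2.1,
        src r₁ hr₁.2.2.2])
    (by
      intro i j k hk
      fin_cases i <;> fin_cases j <;> fin_cases k <;> first | exact absurd rfl hk | skip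
      exacts [h₁₁.1, h₁₁.2.2.1, h₁₂.1, h₁₂.2.2.1, hs₁.1, hs₁.2.2.2, h₂₁.1, h₂₁.2.2.1,
        h₂₂.1, h₂₂.2.2.1, hs₂.1, hs₂.2.2.2, hr₁.1, hr₁.2.1, hr₂.1, hr₂.2.1, hδ.1, hδ.2.1])
    (by
      intro i j k hk
      fin_cases i <;> fin_cases j <;> fin_cases k <;> first | exact absurd rfl hk | skip
      exacts [h₁₁.2.1, h₁₁.2.2.2, h₁₂.2.1, h₁₂.2.2.2, hs₁.2.1, hs₁.2.2.1, h₂₁.2.1, h₂₁.2.2.2,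
        h₂₂.2.1, h₂₂.2.2.2, hs₂.2.1, hs₂.2.2.1, hr₁.2.2.1, hr₁.2.2.2, hr₂.2.2.1, hr₂.2.2.2,
        hδ.2.2.1, hδ.2.2.2])
  obtain ⟨m₁, hm₁⟩ := p₂₁.inter_int δ hδ.2.1 hδ.2.2.1 h₂₁.2.2.1 h₂₁.2.2.2
  obtain ⟨m₂, hm₂⟩ := p₁₂.inter_int δ hδ.1 hδ.2.2.2 h₁₂.2.2.1 h₁₂.2.2.2
  have hn' : (p₁₁.inter p₂₂ + p₁₁.inter s₂ + p₁₂.inter p₂₁ + p₁₂.inter s₂ + s₁.inter p₂₁ +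
      s₁.inter p₂₂) + (p₁₁.inter r₂ + p₁₁.inter δ + p₁₂.inter r₁ + p₁₂.inter δ + s₁.inter r₁ +
      s₁.inter r₂) + (p₂₁.inter r₂ + p₂₁.inter δ + p₂₂.inter r₁ + p₂₂.inter δ + s₂.inter r₁ +
      s₂.inter r₂) = 2 * n + 1 := hn
  rw [i₁, i₂, i₃, i₄, i₅, i₆, i₇, i₈, i₉, i₁₀, i₁₁, i₁₂, i₁₃, i₁₄] at hn'
  refine ⟨n - m₁ - m₂, ?_⟩
  push_cast
  rw [← hm₁, ← hm₂]
  simp only [Path.inter] at hn' ⊢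
  linear_combination hn'

namespace RP2

/-- The point of the projective plane with given homogeneous coordinates. -/
def mk (v : {v : Fin 3 → ℝ // v ≠ 0}) : RP2 := Quotient.mk projSetoid v

theorem mk_eq_mk {v w : {v : Fin 3 → ℝ // v ≠ 0}} :
    mk v = mk w ↔ ∃ c : ℝ, c ≠ 0 ∧ c • v.1 = w.1 := Quotient.eq (r := projSetoid)

theorem isOpen_iff {S : Set RP2} : IsOpen S ↔ IsOpen (mk ⁻¹' S) := Iff.rfl

theorem continuous_mk : Continuous mk := continuous_quot_mk

theorem exists_mk (p : RP2) : ∃ v, mk v = p := Quotient.exists_rep p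

/-- The rank one projection attached to a nonzero vector. -/
def proj (v : {v : Fin 3 → ℝ // v ≠ 0}) (x : Fin 3 × Fin 3) : ℝ :=
  v.1 x.1 * v.1 x.2 / ∑ i, v.1 i ^ 2

theorem sum_sq_ne_zero (v : {v : Fin 3 → ℝ // v ≠ 0}) : ∑ i, v.1 i ^ 2 ≠ 0 := by
  obtain ⟨i, hi⟩ := Function.ne_iff.1 v.2
  exact (Finset.sum_pos' (fun j _ => sq_nonneg _)
    ⟨i, Finset.mem_univ i, by have : v.1 i ≠ 0 := hi; positivity⟩).ne'

theorem continuous_coord (i : Fin 3) :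
    Continuous fun v : {v : Fin 3 → ℝ // v ≠ 0} => v.1 i :=
  (continuous_apply i).comp continuous_subtype_val

theorem continuous_proj : Continuous proj := by
  refine continuous_pi fun x => Continuous.div
    ((continuous_coord _).mul (continuous_coord _))
    (continuous_finsetSum _ fun i _ => (continuous_coord i).pow 2) sum_sq_ne_zero

theorem proj_eq_iff {v w : {v : Fin 3 → ℝ // v ≠ 0}} : proj v = proj w ↔ mk v = mk w := by
  rw [mk_eq_mk]
  have hv := sum_sq_ne_zero v
  have hw := sum_sq_ne_zero w
  constructor
  · intro h
    obtain ⟨i, hi⟩ := Function.ne_iff.1 v.2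
    have hi : v.1 i ≠ 0 := hi
    have h' : ∀ j, v.1 i * v.1 j / ∑ i, v.1 i ^ 2 = w.1 i * w.1 j / ∑ i, w.1 i ^ 2 :=
      fun j => congrFun h (i, j)
    have hwi : w.1 i ≠ 0 := by
      intro h0
      have := h' i
      rw [h0, zero_mul, zero_div, div_eq_zero_iff] at this
      simp_all
    refine ⟨v.1 i * (∑ i, w.1 i ^ 2) / (w.1 i * ∑ i, v.1 i ^ 2), by positivity, ?_⟩
    funext j
    have := h' j
    simp only [Pi.smul_apply, smul_eq_mul]
    field_simp at this ⊢
    linear_combination this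
  · rintro ⟨c, hc, h⟩
    funext x
    simp only [proj, ← h, Pi.smul_apply, smul_eq_mul, mul_pow, ← Finset.mul_sum]
    field_simp

instance : T2Space RP2 := by
  refine T2Space.of_injective_continuous (f := Quotient.lift proj fun v w h =>
    proj_eq_iff.2 (Quotient.sound (s := projSetoid) h)) ?_ (continuous_proj.quotient_lift _)
  intro p q h
  obtain ⟨v, rfl⟩ := exists_mk p
  obtain ⟨w, rfl⟩ := exists_mk q
  exact proj_eq_iff.1 h

/-- The affine chart, with the plane identified with `ℂ`. -/
def ofComplex (z : ℂ) : RP2 := planeToRP2 (z.re, z.im)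

theorem mk_eq_ofComplex {v : {v : Fin 3 → ℝ // v ≠ 0}} {z : ℂ} :
    mk v = ofComplex z ↔ v.1 2 ≠ 0 ∧ z = (v.1 0 / v.1 2 : ℝ) + (v.1 1 / v.1 2 : ℝ) * Complex.I := by
  refine mk_eq_mk.trans ⟨?_, ?_⟩
  · rintro ⟨c, hc, h⟩
    have h0 : c * v.1 0 = z.re := congrFun h 0
    have h1 : c * v.1 1 = z.im := congrFun h 1
    have h2 : c * v.1 2 = 1 := congrFun h 2
    have hv : v.1 2 ≠ 0 := fun h => by simp [h] at h2
    refine ⟨hv, ?_⟩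
    rw [← Complex.re_add_im z, ← h0, ← h1, eq_div_of_mul_eq hv h2, one_div_mul_eq_div,
      one_div_mul_eq_div]
  · rintro ⟨hv, hz⟩
    have h0 : z.re = v.1 0 / v.1 2 := by rw [hz]; simp [-Complex.ofReal_div]
    have h1 : z.im = v.1 1 / v.1 2 := by rw [hz]; simp [-Complex.ofReal_div]
    refine ⟨(v.1 2)⁻¹, inv_ne_zero hv, ?_⟩
    funext i
    fin_cases i
    · simp [h0]; field_simp
    · simp [h1]; field_simp
    · simp [hv]

theorem ofComplex_eq_mk (z : ℂ) : ofComplex z = mk ⟨![z.re, z.im, 1], fun h => by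
    simpa using congrFun h 2⟩ := rfl

theorem ofComplex_injective : Function.Injective ofComplex := by
  intro z w h
  rw [ofComplex_eq_mk, mk_eq_ofComplex] at h
  rw [h.2]; simp

theorem continuous_ofComplex : Continuous ofComplex := by
  refine continuous_mk.comp (Continuous.subtype_mk ?_ _)
  refine continuous_pi fun i => ?_
  fin_cases i <;> simp <;> fun_prop

theorem isOpenMap_ofComplex : IsOpenMap ofComplex := by
  intro O hO
  rw [isOpen_iff]
  have : mk ⁻¹' (ofComplex '' O) = {v | v.1 2 ≠ 0} ∩
      (fun v => ((v.1 0 / v.1 2 : ℝ) + (v.1 1 / v.1 2 : ℝ) * Complex.I : ℂ)) ⁻¹' O := by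
    ext v
    constructor
    · rintro ⟨z, hz, h⟩
      obtain ⟨h1, rfl⟩ := mk_eq_ofComplex.1 h.symm
      exact ⟨h1, hz⟩
    · rintro ⟨h1, h2⟩
      exact ⟨_, h2, (mk_eq_ofComplex.2 ⟨h1, rfl⟩).symm⟩
  rw [this]
  refine ContinuousOn.isOpen_inter_preimage ?_ ?_ hO
  · have h : ∀ i : Fin 3, ContinuousOn (fun v : {v : Fin 3 → ℝ // v ≠ 0} => v.1 i / v.1 2)
        {v | v.1 2 ≠ 0} := fun i =>
      ContinuousOn.div (continuous_coord i).continuousOn (continuous_coord 2).continuousOn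
        fun v hv => hv
    exact (Complex.continuous_ofReal.comp_continuousOn (h 0)).add
      ((Complex.continuous_ofReal.comp_continuousOn (h 1)).mul continuousOn_const)
  · exact isOpen_ne_fun (continuous_coord 2) continuous_const

theorem isOpenEmbedding_ofComplex : Topology.IsOpenEmbedding ofComplex :=
  .of_continuous_injective_isOpenMap continuous_ofComplex ofComplex_injective
    isOpenMap_ofComplex

theorem isOpen_compl_image_closedBall (R : ℝ) :
    IsOpen (ofComplex '' Metric.closedBall 0 R)ᶜ :=
  ((isCompact_closedBall _ _).image continuous_ofComplex).isClosed.isOpen_compl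

end RP2

namespace Path

/-- The winding number of a closed path is zero around points far away. -/
theorem wind_eq_zero_of_norm_le {a q : ℂ} (p : Path a a) (hq : q ∉ range p)
    (hle : ∀ t, ‖p t‖ ≤ ‖q‖) : p.wind q = 0 :=
  logInc_eq_zero_of_norm_le (by simp) hq hle

theorem wind_eq_of_ball {a z w : ℂ} {r : ℝ} (p : Path a a)
    (h : Disjoint (range p) (Metric.ball z r)) (hw : w ∈ Metric.ball z r) :
    p.wind w = p.wind z := by
  have hz : z ∈ Metric.ball z r := Metric.mem_ball_self (Metric.pos_of_mem_ball hw)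
  have := ((convex_ball z r).isPathConnected ⟨z, hz⟩).joinedIn w hw z hz
  obtain ⟨q, hq⟩ := this
  exact p.wind_eq_of_disjoint q (h.mono_right (range_subset_iff.2 hq))

open Classical in
/-- The winding number as a function on the projective plane, extended by zero to the line
at infinity. -/
def windRP {a : ℂ} (p : Path a a) (x : RP2) : ℂ :=
  if h : ∃ z, RP2.ofComplex z = x then p.wind h.choose else 0

theorem windRP_ofComplex {a : ℂ} (p : Path a a) (z : ℂ) :
    p.windRP (RP2.ofComplex z) = p.wind z := by
  have h : ∃ w, RP2.ofComplex w = RP2.ofComplex z := ⟨z, rfl⟩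
  rw [windRP, dif_pos h, RP2.ofComplex_injective h.choose_spec]

theorem windRP_eventually {a : ℂ} (p : Path a a) {x : RP2}
    (hx : x ∉ RP2.ofComplex '' range p) : ∀ᶠ y in nhds x, p.windRP y = p.windRP x := by
  have hcp : IsCompact (range p) := isCompact_range p.continuous
  by_cases h : ∃ z, RP2.ofComplex z = x
  · obtain ⟨z, rfl⟩ := h
    have hz : z ∈ (range p)ᶜ := fun h => hx ⟨z, h, rfl⟩
    obtain ⟨r, hr, hb⟩ := Metric.isOpen_iff.1 hcp.isClosed.isOpen_compl z hz
    refine Filter.eventually_of_mem ((RP2.isOpenMap_ofComplex _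
      (Metric.isOpen_ball (x := z) (ε := r))).mem_nhds ⟨z, Metric.mem_ball_self hr, rfl⟩) ?_
    rintro _ ⟨w, hw, rfl⟩
    rw [windRP_ofComplex, windRP_ofComplex]
    exact p.wind_eq_of_ball (disjoint_left.2 fun y h1 h2 => hb h2 h1) hw
  · obtain ⟨R, hR⟩ := hcp.isBounded.subset_closedBall 0
    refine Filter.eventually_of_mem ((RP2.isOpen_compl_image_closedBall R).mem_nhds
      fun ⟨z, _, hz⟩ => h ⟨z, hz⟩) fun y hy => ?_
    rw [windRP, windRP, dif_neg h]
    split_ifs with hy'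
    · have hn : hy'.choose ∉ Metric.closedBall 0 R := fun h' => hy ⟨_, h', hy'.choose_spec⟩
      refine p.wind_eq_zero_of_norm_le (fun h' => hn (hR h')) fun t => ?_
      have h1 := hR ⟨t, rfl⟩
      rw [mem_closedBall_zero_iff] at h1 hn
      exact h1.trans (not_le.1 hn).le
    · rfl

theorem windRP_eq {a : ℂ} (p : Path a a) {T : Set I} (hT : IsPreconnected T) {c : I → RP2}
    (hc : Continuous c) (h : ∀ t ∈ T, c t ∉ RP2.ofComplex '' range p) {s t : I} (hs : s ∈ T)
    (ht : t ∈ T) : p.windRP (c s) = p.windRP (c t) := by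
  have : PreconnectedSpace T := isPreconnected_iff_preconnectedSpace.1 hT
  have hl : IsLocallyConstant fun t : T => p.windRP (c t) :=
    (IsLocallyConstant.iff_eventually_eq _).2 fun t =>
      (hc.comp continuous_subtype_val).continuousAt.eventually (p.windRP_eventually (h t t.2))
  exact hl.apply_eq_of_isPreconnected isPreconnected_univ (mem_univ (⟨s, hs⟩ : T))
    (mem_univ (⟨t, ht⟩ : T))

end Path

/-- The part of a simple closed curve complementary to a simple arc, in the increasing case. -/
theorem exists_complementary_arc_of_monotone {X : Type*} [TopologicalSpace X]
    {f : AddCircle (1 : ℝ) → X} (hf : Continuous f) (hfi : Function.Injective f)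
    {K : I → ℝ} (hK : Continuous K) (hKm : StrictMono K)
    (hi : Function.Injective fun t => f (K t)) :
    ∃ c : C(I, X), c 0 = f (K 1) ∧ c 1 = f (K 0) ∧ (∀ t, c t ∈ range f) ∧
      ∀ t, t ≠ 0 → t ≠ 1 → ∀ s, c t ≠ f (K s) := by
  have h01 : K 0 < K 1 := hKm zero_lt_one
  have hlt : K 1 < K 0 + 1 := by
    by_contra! h
    obtain ⟨t, -, ht⟩ := isPreconnected_univ.intermediate_value (mem_univ (0 : I)) (mem_univ 1)
      hK.continuousOn (show K 0 + 1 ∈ Icc (K 0) (K 1) from ⟨by linarith, h⟩)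
    have : t = 0 := hi (by
      simp only [ht, AddCircle.coe_add, AddCircle.coe_period, add_zero])
    rw [this] at ht
    linarith
  refine ⟨⟨fun t => f ((K 1 + t * (K 0 + 1 - K 1) : ℝ) : AddCircle (1 : ℝ)),
    hf.comp ((AddCircle.continuous_mk' 1).comp (by fun_prop))⟩, by simp, by simp,
    fun t => ⟨_, rfl⟩, fun t ht0 ht1 s hs => ?_⟩
  have hs := hfi hs
  have h0 : (0 : ℝ) < t := unitInterval.pos_iff_ne_zero.2 ht0
  have h1 : (t : ℝ) < 1 := unitInterval.lt_one_iff_ne_one.2 ht1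
  have hs0 : K 0 ≤ K s := hKm.monotone s.2.1
  have hs1 : K s ≤ K 1 := hKm.monotone s.2.2
  rw [← sub_eq_zero, ← AddCircle.coe_sub, AddCircle.coe_eq_zero_iff] at hs
  obtain ⟨n, hn⟩ := hs
  rw [zsmul_eq_mul, mul_one] at hn
  have e1 : (0 : ℝ) < n := by rw [hn]; nlinarith
  have e2 : (n : ℝ) < 1 := by rw [hn]; nlinarith
  have e1' : 0 < n := by exact_mod_cast e1
  have e2' : n < 1 := by exact_mod_cast e2
  omega

/-- The part of a simple closed curve complementary to a simple arc. -/
theorem exists_complementary_arc {X : Type*} [TopologicalSpace X] [T2Space X]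
    {f : AddCircle (1 : ℝ) → X} (hf : Continuous f) (hfi : Function.Injective f)
    {e : I → X} (he : Continuous e) (hei : Function.Injective e) (hef : ∀ t, e t ∈ range f) :
    ∃ c : C(I, X), c 0 = e 1 ∧ c 1 = e 0 ∧ (∀ t, c t ∈ range f) ∧
      ∀ t, t ≠ 0 → t ≠ 1 → ∀ s, c t ≠ e s := by
  have hemb : Topology.IsClosedEmbedding f := hf.isClosedEmbedding hfi
  choose θ hθ using hef
  have hθc : Continuous θ := hemb.isEmbedding.continuous_iff.2 (by
    rw [show f ∘ θ = e from funext hθ]; exact he)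
  obtain ⟨x, hx⟩ := QuotientAddGroup.mk_surjective (θ 0)
  obtain ⟨K, hK, -⟩ := (AddCircle.isCoveringMap_coe (1 : ℝ)).exists_path_lifts ⟨θ, hθc⟩ x hx.symm
  have hK' : ∀ t, ((K t : ℝ) : AddCircle (1 : ℝ)) = θ t := fun t => congrFun hK t
  have hi : Function.Injective fun t => f (K t) := by
    simpa only [hK', hθ] using hei
  have hKi : Function.Injective K := fun s t h => hi (by simp only [h])
  have he' : ∀ t, e t = f (K t) := fun t => by rw [hK', hθ]
  simp only [he']
  rcases K.continuous.strictMono_of_inj hKi with hm | hm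
  · exact exists_complementary_arc_of_monotone hf hfi K.continuous hm hi
  · obtain ⟨c, h0, h1, h2, h3⟩ := exists_complementary_arc_of_monotone hf hfi
      (K := fun t => K (σ t)) (by fun_prop)
      (fun s t h => hm (unitInterval.symm_lt_symm.2 h))
      (fun s t h => unitInterval.symm_bijective.1 (hi h))
    refine ⟨c.comp ⟨σ, by fun_prop⟩, ?_, ?_, fun t => h2 _, fun t ht0 ht1 s hs => ?_⟩
    · simpa using h1
    · simpa using h0
    · refine h3 (σ t) ?_ ?_ (σ s) ?_
      · rwa [Ne, unitInterval.symm_eq_zero]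
      · rwa [Ne, unitInterval.symm_eq_one]
      · simpa using hs

/-- A pseudoline contains an arc complementary to a given simple arc. -/
theorem IsPseudoline.exists_arc {L : Set RP2} (hL : IsPseudoline L) {a b : ℂ} (e : Path a b)
    (hei : Function.Injective e) (heL : ∀ t, RP2.ofComplex (e t) ∈ L) :
    ∃ c : C(I, RP2), c 0 = RP2.ofComplex b ∧ c 1 = RP2.ofComplex a ∧ (∀ t, c t ∈ L) ∧
      ∀ t, t ≠ 0 → t ≠ 1 → c t ∉ RP2.ofComplex '' range e := by
  obtain ⟨f, hf, hfi, rfl, -⟩ := hL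
  obtain ⟨c, h0, h1, h2, h3⟩ := exists_complementary_arc hf hfi
    (e := fun t => RP2.ofComplex (e t)) (RP2.continuous_ofComplex.comp e.continuous)
    (RP2.ofComplex_injective.comp hei) heL
  refine ⟨c, by simpa using h0, by simpa using h1, h2, fun t ht0 ht1 => ?_⟩
  rintro ⟨_, ⟨s, rfl⟩, hs⟩
  exact h3 t ht0 ht1 s hs.symm

/-- In a pseudolinear drawing, if `e₁` and `e₂` cross algebraically at `x` and `γ` is a closed
curve in the union of `e₀` and the parts of `e₁` and `e₂` before `x`, then `γ` does not wind
around the endpoint of `e₁`. -/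
theorem wind_eq_zero_of_isPseudoline {L₁ L₂ : Set RP2} (h₁ : IsPseudoline L₁)
    (h₂ : IsPseudoline L₂) {v₁ v₂ a b x : ℂ} (e₁ : Path v₁ b) (e₂ : Path v₂ a)
    (hi₁ : Function.Injective e₁) (hi₂ : Function.Injective e₂)
    (hL₁ : ∀ t, RP2.ofComplex (e₁ t) ∈ L₁) (hL₂ : ∀ t, RP2.ofComplex (e₂ t) ∈ L₂)
    (hx₁ : x ∈ range e₁) (hx₂ : x ∈ range e₂)
    (h₁₂ : ∀ p, p ∈ L₁ → p ∈ L₂ → p = RP2.ofComplex x)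
    (hxv₁ : x ≠ v₁) (hxb : x ≠ b) (hxv₂ : x ≠ v₂) (hxa : x ≠ a)
    (hne : e₁.inter e₂ ≠ 0) (γ : Path v₁ v₁)
    (hγL : ∀ z ∈ range γ, RP2.ofComplex z ∈ L₁ → z ∈ range e₁) (hbγ : b ∉ range γ) :
    γ.wind b = 0 := by
  obtain ⟨c, hc0, hc1, hcL, hce⟩ := h₁.exists_arc e₁ hi₁ hL₁
  obtain ⟨d, hd0, hd1, hdL, hde⟩ := h₂.exists_arc e₂ hi₂ hL₂
  have hcγ : ∀ t ∈ ({1}ᶜ : Set I), c t ∉ RP2.ofComplex '' range γ := by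
    rintro t ht ⟨z, hz, hzt⟩
    rcases eq_or_ne t 0 with rfl | ht0
    · rw [hc0] at hzt
      exact hbγ (RP2.ofComplex_injective hzt ▸ hz)
    · exact hce t ht0 ht (hzt ▸ mem_image_of_mem _ (hγL z hz (hzt ▸ hcL t)))
  have hpre : IsPreconnected ({1}ᶜ : Set I) := by
    rw [show ({1}ᶜ : Set I) = Iio 1 by ext t; simp [unitInterval.lt_one_iff_ne_one]]
    exact isPreconnected_Iio
  have hconst : ∀ t ∈ ({1}ᶜ : Set I), γ.windRP (c t) = γ.wind b := fun t ht => by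
    rw [γ.windRP_eq hpre c.continuous hcγ ht (t := 0) (by simp), hc0, γ.windRP_ofComplex]
  by_contra hw
  have haff : ∀ t, ∃ z, RP2.ofComplex z = c t := fun t => by
    rcases eq_or_ne t 1 with rfl | ht
    · exact ⟨_, hc1.symm⟩
    · by_contra hz
      refine hw ?_
      rw [← hconst t ht, Path.windRP, dif_neg hz]
  choose c' hc' using haff
  have hcc : Continuous c' := RP2.isOpenEmbedding_ofComplex.isEmbedding.continuous_iff.2 (by
    rw [show RP2.ofComplex ∘ c' = c from funext hc']; exact c.continuous)
  let q : Path b v₁ := ⟨⟨c', hcc⟩, RP2.ofComplex_injective ((hc' 0).trans hc0),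
    RP2.ofComplex_injective ((hc' 1).trans hc1)⟩
  have hq : ∀ t, RP2.ofComplex (q t) = c t := hc'
  have hxq : x ∉ range q := by
    rintro ⟨t, ht⟩
    rcases eq_or_ne t 0 with rfl | ht0
    · exact hxb (by rw [← ht, q.source])
    rcases eq_or_ne t 1 with rfl | ht1
    · exact hxv₁ (by rw [← ht, q.target])
    · exact hce t ht0 ht1 ⟨x, hx₁, by rw [← hq, ht]⟩
  have hqL : ∀ z ∈ range q, RP2.ofComplex z ∈ L₁ := by
    rintro _ ⟨t, rfl⟩; rw [hq]; exact hcL t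
  have heL : ∀ z ∈ range e₁, RP2.ofComplex z ∈ L₁ := by
    rintro _ ⟨t, rfl⟩; exact hL₁ t
  have heL₂ : ∀ z ∈ range e₂, RP2.ofComplex z ∈ L₂ := by
    rintro _ ⟨t, rfl⟩; exact hL₂ t
  have hun : ∀ z, RP2.ofComplex z ∈ L₁ → RP2.ofComplex z ∈ L₂ → z = x := fun z h h' =>
    RP2.ofComplex_injective (h₁₂ _ h h')
  have ha2 : a ∈ range e₂ := ⟨1, e₂.target⟩
  have hv2 : v₂ ∈ range e₂ := ⟨0, e₂.source⟩
  have hdis : ∀ t ∈ univ, d t ∉ RP2.ofComplex '' range (e₁.trans q) := by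
    rintro t - ⟨z, hz, hzt⟩
    have hzL : RP2.ofComplex z ∈ L₁ := by
      rw [Path.trans_range] at hz
      exact hz.elim (heL z) (hqL z)
    have hdx : d t = RP2.ofComplex x := h₁₂ _ (hzt ▸ hzL) (hdL t)
    rcases eq_or_ne t 0 with rfl | ht0
    · exact hxa (RP2.ofComplex_injective (hdx.symm.trans hd0))
    rcases eq_or_ne t 1 with rfl | ht1
    · exact hxv₂ (RP2.ofComplex_injective (hdx.symm.trans hd1))
    · exact hde t ht0 ht1 ⟨x, hx₂, hdx.symm⟩
  have hwd := (e₁.trans q).windRP_eq isPreconnected_univ d.continuous hdis (mem_univ 0) (mem_univ 1)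
  rw [hd0, hd1, Path.windRP_ofComplex, Path.windRP_ofComplex] at hwd
  have hna : ∀ z ∈ range e₂, z ≠ x → z ∉ range e₁ ∧ z ∉ range q := fun z hz hzx =>
    ⟨fun h => hzx (hun z (heL z h) (heL₂ z hz)), fun h => hzx (hun z (hqL z h) (heL₂ z hz))⟩
  have h1 := Path.inter_trans_left e₁ q e₂ (hna _ hv2 hxv₂.symm).1 (hna _ ha2 hxa.symm).1
    (hna _ hv2 hxv₂.symm).2 (hna _ ha2 hxa.symm).2
  rw [Path.inter_closed, hwd, sub_self, Path.inter_eq_zero (p := q) (q := e₂), add_zero] at h1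
  · exact hne h1.symm
  · exact disjoint_left.2 fun z hz hz2 => hxq (hun z (hqL z hz) (heL₂ z hz2) ▸ hz)

namespace Path

/-- A simple path can be split at any of its points. -/
theorem exists_split {a b x : ℂ} (e : Path a b) (he : Function.Injective e) (hx : x ∈ range e) :
    ∃ (p : Path a x) (q : Path x b), range p ⊆ range e ∧ range q ⊆ range e ∧
      (∀ z ∈ range p, z ∈ range q → z = x) ∧
      ∀ w ∉ range e, e.wind w = p.wind w + q.wind w := by
  obtain ⟨s, rfl⟩ := hx
  have hmem : ∀ t : I, (s : ℝ) + t * (1 - s) ∈ I := fun t =>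
    ⟨by nlinarith [s.2.1, s.2.2, t.2.1, t.2.2], by nlinarith [s.2.1, s.2.2, t.2.1, t.2.2]⟩
  let u : I → I := fun t => ⟨s + t * (1 - s), hmem t⟩
  have hu : Continuous u := by fun_prop
  have hu0 : u 0 = s := by ext; simp [u]
  have hu1 : u 1 = 1 := by ext; simp [u]
  refine ⟨⟨⟨fun t => e (t * s), by fun_prop⟩, by simp, by simp⟩,
    ⟨⟨fun t => e (u t), by fun_prop⟩, by simp [hu0], by simp [hu1]⟩, ?_, ?_, ?_, ?_⟩
  · rintro _ ⟨t, rfl⟩; exact ⟨_, rfl⟩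
  · rintro _ ⟨t, rfl⟩; exact ⟨_, rfl⟩
  · rintro _ ⟨t, rfl⟩ ⟨t', ht'⟩
    have h := he ht'
    change e (t * s) = e s
    have h1 : t * s ≤ s := unitInterval.mul_le_right
    have h2 : s ≤ u t' := by
      change (s : ℝ) ≤ s + t' * (1 - s)
      nlinarith [s.2.2, t'.2.1]
    rw [le_antisymm h1 (h ▸ h2)]
  · intro w hw
    obtain ⟨g, hg⟩ := exists_logInc_branch (f := e.toContinuousMap) hw
    rw [wind, wind, wind, logInc_eq g g.continuous hg,
      logInc_eq (fun t => g (t * s)) (by fun_prop) (fun t => hg _),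
      logInc_eq (fun t => g (u t)) (by fun_prop) (fun t => hg _)]
    simp [hu0, hu1]

theorem inter_eq_zero_of_split {a b x c d o : ℂ} {e : Path a b} {p : Path a x} {q : Path x b}
    {f : Path c d} (hp : range p ⊆ range e) (hq : range q ⊆ range e)
    (hpq : ∀ z ∈ range p, z ∈ range q → z = x)
    (hw : ∀ w ∉ range e, e.wind w = p.wind w + q.wind w)
    (hc : c ∉ range e) (hd : d ∉ range e) (hx : x ∉ range f)
    (ho : ∀ z ∈ range e, z ∈ range f → z = o) (h : e.inter f = 0) :
    p.inter f = 0 ∧ q.inter f = 0 := by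
  have hs : p.inter f + q.inter f = 0 := by
    rw [← h]
    simp only [inter, hw c hc, hw d hd]
    ring
  by_cases hop : o ∈ range p ∧ o ∈ range f
  · have hq0 : q.inter f = 0 := inter_eq_zero (disjoint_left.2 fun z hz hzf => by
      have hzo := ho z (hq hz) hzf
      have := hpq o hop.1 (hzo ▸ hz)
      exact hx (this ▸ hop.2))
    exact ⟨by simpa [hq0] using hs, hq0⟩
  · have hp0 : p.inter f = 0 := inter_eq_zero (disjoint_left.2 fun z hz hzf => by
      have hzo := ho z (hp hz) hzf
      exact hop ⟨hzo ▸ hz, hzo ▸ hzf⟩)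
    exact ⟨hp0, by simpa [hp0] using hs⟩

end Path

/-- A drawing of a graph with thick edges `T`, which cross no other edge, and thin edges `S`,
which extend to a pseudoline arrangement. -/
structure Config {V : Type*} (T S : List (V × V)) where
  pos : V → ℂ
  pos_inj : Function.Injective pos
  arc : ∀ u v, Path (pos u) (pos v)
  avoid : ∀ u v, (u, v) ∈ T ++ S → ∀ w, pos w ∈ range (arc u v) → w = u ∨ w = v
  thick : ∀ u v, (u, v) ∈ T → ∀ u' v', (u', v') ∈ T ++ S → (u, v) ≠ (u', v') →
    ∀ z ∈ range (arc u v), z ∈ range (arc u' v') → ∃ w, pos w = z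
  line : V → V → Set RP2
  arc_inj : ∀ u v, (u, v) ∈ S → Function.Injective (arc u v)
  isPseudoline : ∀ u v, (u, v) ∈ S → IsPseudoline (line u v)
  arc_mem_line : ∀ u v, (u, v) ∈ S → ∀ z ∈ range (arc u v), RP2.ofComplex z ∈ line u v
  line_inter : ∀ u v, (u, v) ∈ S → ∀ u' v', (u', v') ∈ S → (u, v) ≠ (u', v') →
    ∀ p ∈ line u v, p ∈ line u' v' → ∀ q ∈ line u v, q ∈ line u' v' → p = q

namespace Config

/-- Restriction of a configuration along an injection of vertex sets. -/
def comap {V W : Type*} {T S : List (V × V)} {T' S' : List (W × W)} (C : Config T S) (ρ : W → V)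
    (hρ : Function.Injective ρ) (hT : ∀ e ∈ T', (ρ e.1, ρ e.2) ∈ T)
    (hS : ∀ e ∈ S', (ρ e.1, ρ e.2) ∈ S) : Config T' S' where
  pos w := C.pos (ρ w)
  pos_inj := C.pos_inj.comp hρ
  arc u v := C.arc (ρ u) (ρ v)
  avoid u v h w hw := by
    refine (C.avoid (ρ u) (ρ v) ?_ (ρ w) hw).imp (fun h => hρ h) (fun h => hρ h)
    rw [List.mem_append] at h ⊢
    exact h.imp (hT _) (hS _)
  thick u v h u' v' h' hne z hz hz' := by
    have h'' : (ρ u', ρ v') ∈ T ++ S := by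
      rw [List.mem_append] at h' ⊢
      exact h'.imp (hT _) (hS _)
    have hne' : (ρ u, ρ v) ≠ (ρ u', ρ v') := fun e => hne (by
      rw [Prod.mk.injEq] at e ⊢
      exact ⟨hρ e.1, hρ e.2⟩)
    obtain ⟨w, hw⟩ := C.thick _ _ (hT _ h) _ _ h'' hne' z hz hz'
    have h1 := C.avoid (ρ u) (ρ v) (List.mem_append_left _ (hT _ h)) w (hw ▸ hz)
    rcases h1 with rfl | rfl
    · exact ⟨u, hw⟩
    · exact ⟨v, hw⟩
  line u v := C.line (ρ u) (ρ v)
  arc_inj u v h := C.arc_inj _ _ (hS _ h)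
  isPseudoline u v h := C.isPseudoline _ _ (hS _ h)
  arc_mem_line u v h := C.arc_mem_line _ _ (hS _ h)
  line_inter u v h u' v' h' hne := C.line_inter _ _ (hS _ h) _ _ (hS _ h') fun e => hne (by
    rw [Prod.mk.injEq] at e ⊢
    exact ⟨hρ e.1, hρ e.2⟩)

variable {V : Type*} {T S : List (V × V)} (C : Config T S)

theorem notMem {u v w : V} (h : (u, v) ∈ T ++ S ∧ w ≠ u ∧ w ≠ v) :
    C.pos w ∉ range (C.arc u v) := fun hw =>
  (C.avoid u v h.1 w hw).elim h.2.1 h.2.2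

theorem disjoint {u v u' v' : V} (h : (u, v) ∈ T ∧ (u', v') ∈ T ++ S ∧ u ≠ u' ∧ u ≠ v' ∧
    v ≠ u' ∧ v ≠ v') : Disjoint (range (C.arc u v)) (range (C.arc u' v')) := by
  refine disjoint_left.2 fun z hz hz' => ?_
  obtain ⟨h1, h2, h3, h4, h5, h6⟩ := h
  obtain ⟨w, rfl⟩ := C.thick _ _ h1 _ _ h2 (fun e => h3 (congrArg Prod.fst e)) z hz hz'
  have e1 := C.avoid _ _ (List.mem_append_left _ h1) _ hz
  have e2 := C.avoid _ _ h2 _ hz'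
  grind

theorem disjoint' {u v u' v' : V} (h : (u, v) ∈ T ∧ (u', v') ∈ T ++ S ∧ u ≠ u' ∧ u ≠ v' ∧
    v ≠ u' ∧ v ≠ v') : Disjoint (range (C.arc u' v')) (range (C.arc u v)) :=
  (C.disjoint h).symm

/-- Two thin edges with a common endpoint have no other common point. -/
theorem eq_pos {u v u' v' w : V} {z : ℂ} (h : (u, v) ∈ S ∧ (u', v') ∈ S ∧ (u, v) ≠ (u', v') ∧
    (w = u ∨ w = v) ∧ (w = u' ∨ w = v')) (hz : RP2.ofComplex z ∈ C.line u v)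
    (hz' : RP2.ofComplex z ∈ C.line u' v') : z = C.pos w := by
  obtain ⟨h1, h2, h3, h4, h5⟩ := h
  refine RP2.ofComplex_injective (C.line_inter _ _ h1 _ _ h2 h3 _ hz hz' _
    (C.arc_mem_line _ _ h1 _ ?_) (C.arc_mem_line _ _ h2 _ ?_))
  · rcases h4 with rfl | rfl
    exacts [⟨0, Path.source _⟩, ⟨1, Path.target _⟩]
  · rcases h5 with rfl | rfl
    exacts [⟨0, Path.source _⟩, ⟨1, Path.target _⟩]

/-- A point of a thin edge that is not a vertex is on no thick edge. -/
theorem notMem_thick {u v u' v' : V} {z : ℂ} (hz : z ∈ range (C.arc u v))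
    (hp : ∀ w, z ≠ C.pos w) (h : (u, v) ∈ T ++ S ∧ (u', v') ∈ T ∧ (u', v') ≠ (u, v)) :
    z ∉ range (C.arc u' v') := fun hz' =>
  let ⟨w, hw⟩ := C.thick _ _ h.2.1 _ _ h.1 h.2.2 z hz' hz
  hp w hw.symm

/-- A point of a thin edge that is not a vertex is on no adjacent thin edge. -/
theorem notMem_thin {u v u' v' : V} (w : V) {z : ℂ} (hz : z ∈ range (C.arc u v))
    (hp : ∀ w, z ≠ C.pos w) (h : (u, v) ∈ S ∧ (u', v') ∈ S ∧ (u, v) ≠ (u', v') ∧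
    (w = u ∨ w = v) ∧ (w = u' ∨ w = v')) :
    z ∉ range (C.arc u' v') := fun hz' =>
  hp w (C.eq_pos h (C.arc_mem_line _ _ h.1 _ hz) (C.arc_mem_line _ _ h.2.1 _ hz'))

/-- A common point of two independent edges is not a vertex. -/
theorem ne_pos {u v u' v' : V} {z : ℂ} (h : (u, v) ∈ T ++ S ∧ (u', v') ∈ T ++ S ∧ u ≠ u' ∧
    u ≠ v' ∧ v ≠ u' ∧ v ≠ v') (hz : z ∈ range (C.arc u v)) (hz' : z ∈ range (C.arc u' v'))
    (w : V) : z ≠ C.pos w := by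
  rintro rfl
  have e1 := C.avoid _ _ h.1 _ hz
  have e2 := C.avoid _ _ h.2.1 _ hz'
  grind

end Config

theorem Path.inter_eq_zero_of_split_split {a b x c d y : ℂ} {e : Path a b} {p : Path a x}
    {q : Path x b} {f : Path c d} {p' : Path c y} {q' : Path y d}
    (hp : range p ⊆ range e) (hq : range q ⊆ range e) (hpq : ∀ z ∈ range p, z ∈ range q → z = x)
    (hw : ∀ w ∉ range e, e.wind w = p.wind w + q.wind w)
    (hp' : range p' ⊆ range f) (hq' : range q' ⊆ range f)
    (hpq' : ∀ z ∈ range p', z ∈ range q' → z = y)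
    (hw' : ∀ w ∉ range f, f.wind w = p'.wind w + q'.wind w)
    (ha : a ∉ range f) (hb : b ∉ range f) (hc : c ∉ range e) (hd : d ∉ range e)
    (hx : x ∉ range f) (hy : y ∉ range e)
    (ho : ∀ z ∈ range e, z ∈ range f → ∀ z' ∈ range e, z' ∈ range f → z = z')
    (h : e.inter f = 0) : p.inter p' = 0 ∧ p'.inter q = 0 := by
  obtain ⟨o, ho⟩ : ∃ o, ∀ z ∈ range e, z ∈ range f → z = o := by
    by_cases hne : ∃ o, o ∈ range e ∧ o ∈ range f
    · obtain ⟨o, h1, h2⟩ := hne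
      exact ⟨o, fun z hz hz' => ho z hz hz' o h1 h2⟩
    · exact ⟨0, fun z hz hz' => absurd ⟨z, hz, hz'⟩ hne⟩
  obtain ⟨h1, h2⟩ := inter_eq_zero_of_split hp hq hpq hw hc hd hx ho h
  have h3 := inter_eq_zero_of_split hp' hq' hpq' hw' ha hx (fun h => hy (hp h))
    (fun z hz hz' => ho z (hp hz') hz) (by rw [Path.inter_comm, h1, neg_zero])
  have h4 := inter_eq_zero_of_split hp' hq' hpq' hw' hx hb (fun h => hy (hq h))
    (fun z hz hz' => ho z (hq hz') hz) (by rw [Path.inter_comm, h2, neg_zero])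
  exact ⟨by rw [Path.inter_comm, h3.1, neg_zero], h4.1⟩

/-- The thick edges of a half of the core graph: an octahedron-like frame with hub `6`, the fence
`7, 8, 9, 10`, and two edges from the frame to the fence. -/
def halfT : List (Fin 11 × Fin 11) :=
  [(0, 2), (2, 3), (3, 1), (0, 5), (5, 4), (4, 1), (6, 2), (6, 3), (6, 4), (6, 5),
    (7, 8), (8, 9), (9, 10), (10, 7), (0, 7), (1, 9)]

/-- The thin edges of a half of the core graph. -/
def halfS : List (Fin 11 × Fin 11) := [(0, 1), (0, 3), (1, 2), (0, 4), (1, 5)]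

namespace Config

variable (C : Config halfT halfS)

set_option maxRecDepth 4000 in
/-- The symmetry of the half core exchanging the two sides of the frame. -/
def swap : Config halfT halfS :=
  C.comap ![0, 1, 5, 4, 3, 2, 6, 7, 8, 9, 10] (by decide) (by decide) (by decide)

theorem inter_ne_zero : (C.arc 0 3).inter (C.arc 1 2) ≠ 0 := by
  intro h0
  let A : Fin 3 → Fin 11 := ![0, 1, 6]
  let B : Fin 3 → Fin 11 := ![2, 3, 5]
  let F : ∀ i j, Path (C.pos (A i)) (C.pos (B j)) := fun i j => match i, j with
    | 0, 0 => C.arc 0 2 | 0, 1 => C.arc 0 3 | 0, 2 => C.arc 0 5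
    | 1, 0 => C.arc 1 2 | 1, 1 => (C.arc 3 1).symm
    | 1, 2 => (C.arc 4 1).symm.trans (C.arc 5 4).symm
    | 2, 0 => C.arc 6 2 | 2, 1 => C.arc 6 3 | 2, 2 => C.arc 6 5
  have hF : ∀ i j : Fin 3, ∀ w, w ≠ A i → w ≠ B j → w ≠ 4 → C.pos w ∉ range (F i j) := by
    intro i j w h1 h2 h3
    fin_cases i <;> fin_cases j
    · exact C.notMem ⟨by decide, h1, h2⟩
    · exact C.notMem ⟨by decide, h1, h2⟩
    · exact C.notMem ⟨by decide, h1, h2⟩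
    · exact C.notMem ⟨by decide, h1, h2⟩
    · change _ ∉ range (C.arc 3 1).symm
      rw [Path.symm_range]; exact C.notMem ⟨by decide, h2, h1⟩
    · change _ ∉ range ((C.arc 4 1).symm.trans (C.arc 5 4).symm)
      rw [Path.trans_range, Path.symm_range, Path.symm_range, mem_union, not_or]
      exact ⟨C.notMem ⟨by decide, h3, h1⟩, C.notMem ⟨by decide, h2, h3⟩⟩
    · exact C.notMem ⟨by decide, h1, h2⟩
    · exact C.notMem ⟨by decide, h1, h2⟩
    · exact C.notMem ⟨by decide, h1, h2⟩
  obtain ⟨n, hn⟩ := inter_K33 F (C.pos_inj.comp (by decide)) (C.pos_inj.comp (by decide))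
    (fun i j => C.pos_inj.ne (by revert i j; decide))
    (fun i j k hk => hF i j _ (by revert i k; decide) (by clear hk; revert j k; decide)
      (by clear hk; revert k; decide))
    (fun i j k hk => hF i j _ (by clear hk; revert i k; decide) (by revert j k; decide)
      (by clear hk; revert k; decide))
  have hn' : ((C.arc 0 2).inter (C.arc 3 1).symm +
      (C.arc 0 2).inter ((C.arc 4 1).symm.trans (C.arc 5 4).symm) +
      (C.arc 0 3).inter (C.arc 1 2) +
      (C.arc 0 3).inter ((C.arc 4 1).symm.trans (C.arc 5 4).symm) +
      (C.arc 0 5).inter (C.arc 1 2) + (C.arc 0 5).inter (C.arc 3 1).symm) +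
      ((C.arc 0 2).inter (C.arc 6 3) + (C.arc 0 2).inter (C.arc 6 5) +
      (C.arc 0 3).inter (C.arc 6 2) + (C.arc 0 3).inter (C.arc 6 5) +
      (C.arc 0 5).inter (C.arc 6 2) + (C.arc 0 5).inter (C.arc 6 3)) +
      ((C.arc 1 2).inter (C.arc 6 3) + (C.arc 1 2).inter (C.arc 6 5) +
      (C.arc 3 1).symm.inter (C.arc 6 2) + (C.arc 3 1).symm.inter (C.arc 6 5) +
      ((C.arc 4 1).symm.trans (C.arc 5 4).symm).inter (C.arc 6 2) +
      ((C.arc 4 1).symm.trans (C.arc 5 4).symm).inter (C.arc 6 3)) = 2 * n + 1 := hn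
  simp_rw [h0] at hn'
  repeat rw [Path.inter_eq_zero] at hn'
  · simp only [add_zero] at hn'
    have : (0 : ℤ) = 2 * n + 1 := by exact_mod_cast hn'
    omega
  all_goals
    try simp only [Path.trans_range, Path.symm_range, disjoint_union_left, disjoint_union_right]
    repeat' apply And.intro
    all_goals first | exact C.disjoint (by decide) | exact C.disjoint' (by decide)

theorem inter_eq_zero : (C.arc 0 3).inter (C.arc 1 5) = 0 := by
  have h := Path.inter_closed ((C.arc 0 3).trans ((C.arc 2 3).symm.trans (C.arc 0 2).symm))
    ((C.arc 1 5).trans ((C.arc 5 4).trans (C.arc 4 1)))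
  rw [sub_self, Path.inter_trans_left, Path.inter_trans_right,
    Path.inter_eq_zero (p := C.arc 0 3) (q := (C.arc 5 4).trans (C.arc 4 1)),
    Path.inter_eq_zero (p := (C.arc 2 3).symm.trans (C.arc 0 2).symm), add_zero, add_zero] at h
  · exact h
  all_goals
    try simp only [Path.trans_range, Path.symm_range, disjoint_union_left, disjoint_union_right,
      mem_union, not_or]
    repeat' apply And.intro
    all_goals first
      | exact C.disjoint (by decide)
      | exact C.disjoint' (by decide)
      | exact C.notMem (by decide)

/-- The closed curve around the fence. -/
def fence : Path (C.pos 7) (C.pos 7) :=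
  (C.arc 7 8).trans ((C.arc 8 9).trans ((C.arc 9 10).trans (C.arc 10 7)))

theorem exists_loop {x : ℂ} (h₁ : x ∈ range (C.arc 0 3)) (h₂ : x ∈ range (C.arc 1 2))
    (p₁ : Path (C.pos 0) x) (p₂ : Path (C.pos 1) x) (hp₁ : range p₁ ⊆ range (C.arc 0 3))
    (hp₂ : range p₂ ⊆ range (C.arc 1 2)) (hb : C.pos 3 ∉ range p₁) :
    ∃ γ : Path (C.pos 0) (C.pos 0), (∀ w ∉ range (C.arc 0 3), w ∉ range (C.arc 1 2) →
      w ∉ range (C.arc 0 1) → γ.wind w = p₁.wind w - p₂.wind w - (C.arc 0 1).wind w) ∧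
      γ.wind (C.pos 6) = 0 ∧ (γ.wind (C.pos 7) ≠ 0 → C.fence.wind (C.pos 0) = 0) := by
  let γ : Path (C.pos 0) (C.pos 0) := p₁.trans (p₂.symm.trans (C.arc 0 1).symm)
  have hγr : range γ = range p₁ ∪ (range p₂ ∪ range (C.arc 0 1)) := by
    simp only [γ, Path.trans_range, Path.symm_range]
  have hγ : ∀ w ∉ range (C.arc 0 3), w ∉ range (C.arc 1 2) →
      w ∉ range (C.arc 0 1) → γ.wind w = p₁.wind w - p₂.wind w - (C.arc 0 1).wind w := by
    intro w h1 h2 h0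
    have h1' : w ∉ range p₁ := fun h => h1 (hp₁ h)
    have h2' : w ∉ range p₂ := fun h => h2 (hp₂ h)
    rw [Path.wind_trans _ _ h1' (by
      rw [Path.trans_range, Path.symm_range, Path.symm_range]; exact fun h => h.elim h2' h0),
      Path.wind_trans _ _ (by rwa [Path.symm_range]) (by rwa [Path.symm_range]),
      Path.wind_symm _ h2', Path.wind_symm _ h0]
    ring
  have hx := C.ne_pos (by decide) h₁ h₂
  have hb0 : γ.wind (C.pos 3) = 0 := by
    refine wind_eq_zero_of_isPseudoline (C.isPseudoline 0 3 (by decide))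
      (C.isPseudoline 1 2 (by decide)) (C.arc 0 3) (C.arc 1 2) (C.arc_inj 0 3 (by decide))
      (C.arc_inj 1 2 (by decide)) (fun t => C.arc_mem_line 0 3 (by decide) _ ⟨t, rfl⟩)
      (fun t => C.arc_mem_line 1 2 (by decide) _ ⟨t, rfl⟩) h₁ h₂ (fun p hp hp' =>
        C.line_inter 0 3 (by decide) 1 2 (by decide) (by decide) p hp hp' _
          (C.arc_mem_line 0 3 (by decide) _ h₁) (C.arc_mem_line 1 2 (by decide) _ h₂))
      (hx 0) (hx 3) (hx 1) (hx 2) C.inter_ne_zero γ ?_ ?_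
    · intro z hz hzL
      rw [hγr] at hz
      rcases hz with hz | hz | hz
      · exact hp₁ hz
      · have := RP2.ofComplex_injective (C.line_inter 0 3 (by decide) 1 2 (by decide) (by decide) _
          hzL (C.arc_mem_line 1 2 (by decide) _ (hp₂ hz)) _
          (C.arc_mem_line 0 3 (by decide) _ h₁) (C.arc_mem_line 1 2 (by decide) _ h₂))
        exact this ▸ h₁
      · rw [C.eq_pos (w := 0) (u := 0) (v := 3) (u' := 0) (v' := 1) (by decide) hzL
          (C.arc_mem_line 0 1 (by decide) _ hz)]
        exact ⟨0, Path.source _⟩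
    · rw [hγr]
      rintro (h | h | h)
      exacts [hb h, C.notMem (by decide) (hp₂ h), C.notMem (by decide) h]
  refine ⟨γ, hγ, ?_, fun h => ?_⟩
  · rw [← hb0]
    refine γ.wind_eq_of_disjoint (C.arc 6 3) ?_
    rw [hγr, disjoint_union_left, disjoint_union_left]
    refine ⟨disjoint_left.2 fun z hz hz' => ?_, (C.disjoint' (by decide)).mono_left hp₂,
      C.disjoint' (by decide)⟩
    obtain ⟨w, rfl⟩ := C.thick 6 3 (by decide) 0 3 (by decide) (by decide) z hz' (hp₁ hz)
    rcases C.avoid 6 3 (by decide) w hz' with rfl | rfl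
    · exact C.notMem (by decide) (hp₁ hz)
    · exact hb hz
  · refine Path.wind_extremal ?_ h
    rw [hγr]
    simp only [fence, Path.trans_range, disjoint_union_left, disjoint_union_right]
    have h1 : ∀ {s : Set ℂ}, Disjoint (range (C.arc 0 3)) s → Disjoint (range p₁) s :=
      fun h => h.mono_left hp₁
    have h2 : ∀ {s : Set ℂ}, Disjoint (range (C.arc 1 2)) s → Disjoint (range p₂) s :=
      fun h => h.mono_left hp₂
    repeat' apply And.intro
    all_goals first
      | exact C.disjoint' (by decide)
      | exact h1 (C.disjoint' (by decide))
      | exact h2 (C.disjoint' (by decide))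

theorem wind_fence : C.fence.wind (C.pos 0) = 0 := by
  have hex : ∀ C : Config halfT halfS, ∃ x, x ∈ range (C.arc 0 3) ∧ x ∈ range (C.arc 1 2) := by
    intro C
    by_contra! h
    exact C.inter_ne_zero (Path.inter_eq_zero (disjoint_left.2 h))
  obtain ⟨x, hx₁, hx₂⟩ := hex C
  obtain ⟨y, hy₃, hy₄⟩ := hex C.swap
  change y ∈ range (C.arc 0 4) at hy₃
  change y ∈ range (C.arc 1 5) at hy₄
  have hx := C.ne_pos (by decide) hx₁ hx₂
  have hy := C.ne_pos (by decide) hy₃ hy₄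
  obtain ⟨p₁, q₁, hp₁, hq₁, hd₁, hw₁⟩ := (C.arc 0 3).exists_split (C.arc_inj 0 3 (by decide)) hx₁
  obtain ⟨p₂, q₂, hp₂, hq₂, hd₂, hw₂⟩ := (C.arc 1 2).exists_split (C.arc_inj 1 2 (by decide)) hx₂
  obtain ⟨p₃, q₃, hp₃, hq₃, hd₃, hw₃⟩ := (C.arc 0 4).exists_split (C.arc_inj 0 4 (by decide)) hy₃
  obtain ⟨p₄, q₄, hp₄, hq₄, hd₄, hw₄⟩ := (C.arc 1 5).exists_split (C.arc_inj 1 5 (by decide)) hy₄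
  obtain ⟨γ, hγ, hγr, hγz⟩ := C.exists_loop hx₁ hx₂ p₁ p₂ hp₁ hp₂
    fun h => hx 3 (hd₁ _ h ⟨1, q₁.target⟩).symm
  obtain ⟨γ', hγ', hγr', hγz'⟩ := C.swap.exists_loop hy₃ hy₄ p₃ p₄ hp₃ hp₄
    fun h => hy 4 (hd₃ _ h ⟨1, q₃.target⟩).symm
  change ∀ w ∉ range (C.arc 0 4), w ∉ range (C.arc 1 5) → w ∉ range (C.arc 0 1) →
    γ'.wind w = p₃.wind w - p₄.wind w - (C.arc 0 1).wind w at hγ'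
  change γ'.wind (C.pos 6) = 0 at hγr'
  change γ'.wind (C.pos 7) ≠ 0 → C.fence.wind (C.pos 0) = 0 at hγz'
  have hx₃ : x ∉ range (C.arc 0 4) := C.notMem_thin 0 hx₁ hx (by decide)
  have hx₄ : x ∉ range (C.arc 1 5) := C.notMem_thin 1 hx₂ hx (by decide)
  have hy₁ : y ∉ range (C.arc 0 3) := C.notMem_thin 0 hy₃ hy (by decide)
  have hy₂ : y ∉ range (C.arc 1 2) := C.notMem_thin 1 hy₄ hy (by decide)
  have h₁₄ := Path.inter_eq_zero_of_split_split hp₁ hq₁ hd₁ hw₁ hp₄ hq₄ hd₄ hw₄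
    (C.notMem (by decide)) (C.notMem (by decide)) (C.notMem (by decide)) (C.notMem (by decide))
    hx₄ hy₁ (fun z hz hz' z' h h' => RP2.ofComplex_injective
      (C.line_inter 0 3 (by decide) 1 5 (by decide) (by decide) _
        (C.arc_mem_line 0 3 (by decide) _ hz) (C.arc_mem_line 1 5 (by decide) _ hz') _
        (C.arc_mem_line 0 3 (by decide) _ h) (C.arc_mem_line 1 5 (by decide) _ h')))
    C.inter_eq_zero
  have h₃₂ := Path.inter_eq_zero_of_split_split hp₃ hq₃ hd₃ hw₃ hp₂ hq₂ hd₂ hw₂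
    (C.notMem (by decide)) (C.notMem (by decide)) (C.notMem (by decide)) (C.notMem (by decide))
    hy₂ hx₃ (fun z hz hz' z' h h' => RP2.ofComplex_injective
      (C.line_inter 0 4 (by decide) 1 2 (by decide) (by decide) _
        (C.arc_mem_line 0 4 (by decide) _ hz) (C.arc_mem_line 1 2 (by decide) _ hz') _
        (C.arc_mem_line 0 4 (by decide) _ h) (C.arc_mem_line 1 2 (by decide) _ h')))
    C.swap.inter_eq_zero
  have hd₁₃ : Disjoint (range p₁) (range q₃) := disjoint_left.2 fun z hz hz' => by
    have := C.eq_pos (w := 0) (u := 0) (v := 3) (u' := 0) (v' := 4) (by decide)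
      (C.arc_mem_line 0 3 (by decide) _ (hp₁ hz)) (C.arc_mem_line 0 4 (by decide) _ (hq₃ hz'))
    subst this
    exact hy 0 (hd₃ _ ⟨0, p₃.source⟩ hz').symm
  have hd₃₁ : Disjoint (range p₃) (range q₁) := disjoint_left.2 fun z hz hz' => by
    have := C.eq_pos (w := 0) (u := 0) (v := 3) (u' := 0) (v' := 4) (by decide)
      (C.arc_mem_line 0 3 (by decide) _ (hq₁ hz')) (C.arc_mem_line 0 4 (by decide) _ (hp₃ hz))
    subst this
    exact hx 0 (hd₁ _ ⟨0, p₁.source⟩ hz').symm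
  have hq₁0 : C.pos 0 ∉ range q₁ := fun h => hx 0 (hd₁ _ ⟨0, p₁.source⟩ h).symm
  have hq₃0 : C.pos 0 ∉ range q₃ := fun h => hy 0 (hd₃ _ ⟨0, p₃.source⟩ h).symm
  have h0q : ∀ {v} {a : ℂ} {q : Path a (C.pos v)}, (C.pos 0 ∉ range q) → (0, v) ∈ halfS →
      range q ⊆ range (C.arc 0 v) → Disjoint (range (C.arc 0 7)) (range q) :=
    fun h hv hq => disjoint_left.2 fun z hz hz' => by
    obtain ⟨w, rfl⟩ := C.thick 0 7 (by decide) 0 _ (List.mem_append_right _ hv) (by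
      rintro ⟨⟩; revert hv; decide) z hz (hq hz')
    rcases C.avoid 0 7 (by decide) _ hz with rfl | rfl
    · exact h hz'
    · rcases C.avoid 0 _ (List.mem_append_right _ hv) _ (hq hz') with h | rfl
      · cases h
      · exact absurd hv (by decide)
  have d₁ : ∀ {s : Set ℂ}, Disjoint (range (C.arc 0 3)) s → Disjoint (range p₁) s :=
    fun h => h.mono_left hp₁
  have d₂ : ∀ {s : Set ℂ}, Disjoint (range (C.arc 1 2)) s → Disjoint (range p₂) s :=
    fun h => h.mono_left hp₂
  have d₃ : ∀ {s : Set ℂ}, Disjoint (range (C.arc 0 4)) s → Disjoint (range p₃) s :=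
    fun h => h.mono_left hp₃
  have d₄ : ∀ {s : Set ℂ}, Disjoint (range (C.arc 1 5)) s → Disjoint (range p₄) s :=
    fun h => h.mono_left hp₄
  have c₁ : ∀ {s : Set ℂ}, Disjoint s (range (C.arc 0 3)) → Disjoint s (range q₁) :=
    fun h => h.mono_right hq₁
  have c₃ : ∀ {s : Set ℂ}, Disjoint s (range (C.arc 0 4)) → Disjoint s (range q₃) :=
    fun h => h.mono_right hq₃
  have m₁ : ∀ {z}, z ∉ range (C.arc 0 3) → z ∉ range p₁ := fun h h' => h (hp₁ h')
  have m₂ : ∀ {z}, z ∉ range (C.arc 1 2) → z ∉ range p₂ := fun h h' => h (hp₂ h')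
  have m₃ : ∀ {z}, z ∉ range (C.arc 0 4) → z ∉ range p₃ := fun h h' => h (hp₃ h')
  have m₄ : ∀ {z}, z ∉ range (C.arc 1 5) → z ∉ range p₄ := fun h h' => h (hp₄ h')
  have n₁ : ∀ {z}, z ∉ range (C.arc 0 3) → z ∉ range q₁ := fun h h' => h (hq₁ h')
  have n₃ : ∀ {z}, z ∉ range (C.arc 0 4) → z ∉ range q₃ := fun h h' => h (hq₃ h')
  by_contra h0
  refine absurd (odd_wind_sub_wind (p₁₁ := p₁) (p₁₂ := p₃) (p₂₁ := p₂) (p₂₂ := p₄)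
    (r₁ := (C.arc 6 3).trans q₁.symm) (r₂ := (C.arc 6 4).trans q₃.symm) (s₁ := C.arc 0 7)
    (s₂ := (C.arc 1 9).trans ((C.arc 8 9).symm.trans (C.arc 7 8).symm))
    ?_ ?_ ?_ ?_ ?_ ?_ ?_ ?_ h₁₄.1 h₃₂.1 (Path.inter_eq_zero ?_) (Path.inter_eq_zero ?_)
    (Path.inter_eq_zero ?_) (Path.inter_eq_zero ?_) (Path.inter_eq_zero ?_)
    (Path.inter_eq_zero ?_) ?_ ?_ (Path.inter_eq_zero ?_) (Path.inter_eq_zero ?_)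
    (Path.inter_eq_zero ?_) (Path.inter_eq_zero ?_)) ?_
  rotate_right
  · rintro ⟨n, hn⟩
    have e6 : (C.pos 6 ∉ range (C.arc 0 3) ∧ C.pos 6 ∉ range (C.arc 1 2)) ∧
        (C.pos 6 ∉ range (C.arc 0 4) ∧ C.pos 6 ∉ range (C.arc 1 5)) ∧
        C.pos 6 ∉ range (C.arc 0 1) := by
      refine ⟨⟨?_, ?_⟩, ⟨?_, ?_⟩, ?_⟩ <;> exact C.notMem (by decide)
    have e7 : (C.pos 7 ∉ range (C.arc 0 3) ∧ C.pos 7 ∉ range (C.arc 1 2)) ∧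
        (C.pos 7 ∉ range (C.arc 0 4) ∧ C.pos 7 ∉ range (C.arc 1 5)) ∧
        C.pos 7 ∉ range (C.arc 0 1) := by
      refine ⟨⟨?_, ?_⟩, ⟨?_, ?_⟩, ?_⟩ <;> exact C.notMem (by decide)
    have g6 := hγ _ e6.1.1 e6.1.2 e6.2.2
    have g6' := hγ' _ e6.2.1.1 e6.2.1.2 e6.2.2
    have g7 := hγ _ e7.1.1 e7.1.2 e7.2.2
    have g7' := hγ' _ e7.2.1.1 e7.2.1.2 e7.2.2
    rw [not_imp_comm.1 hγz h0] at g7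
    rw [not_imp_comm.1 hγz' h0] at g7'
    rw [hγr] at g6
    rw [hγr'] at g6'
    have : (0 : ℂ) = 2 * n + 1 := by linear_combination hn + g6 - g6' - g7 + g7'
    have : (0 : ℤ) = 2 * n + 1 := by exact_mod_cast this
    omega
  case' refine_15 =>
    rw [Path.inter_trans_right, Path.inter_symm_right, h₃₂.2, Path.inter_eq_zero, neg_zero,
      add_zero]
  case' refine_16 =>
    rw [Path.inter_trans_right, Path.inter_symm_right, h₁₄.2, Path.inter_eq_zero, neg_zero,
      add_zero]
  all_goals
    try simp only [Path.trans_range, Path.symm_range, disjoint_union_left, disjoint_union_right,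
      mem_union, not_or, mem_insert_iff, mem_singleton_iff, forall_eq_or_imp, forall_eq]
    repeat' apply And.intro
    all_goals first
      | exact h0q hq₁0 (by decide) hq₁
      | exact h0q hq₃0 (by decide) hq₃
      | exact C.notMem (by decide)
      | exact m₁ (C.notMem (by decide))
      | exact m₂ (C.notMem (by decide))
      | exact m₃ (C.notMem (by decide))
      | exact m₄ (C.notMem (by decide))
      | exact n₁ (C.notMem (by decide))
      | exact n₃ (C.notMem (by decide))
      | exact m₁ hy₁
      | exact m₂ hy₂
      | exact m₃ hx₃
      | exact m₄ hx₄
      | exact n₁ hy₁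
      | exact n₃ hx₃
      | exact hq₁0
      | exact hq₃0
      | exact C.notMem_thick hx₁ hx (by decide)
      | exact C.notMem_thick hy₃ hy (by decide)
      | exact hd₁₃
      | exact hd₃₁
      | exact C.disjoint (by decide)
      | exact C.disjoint' (by decide)
      | exact d₁ (C.disjoint' (by decide))
      | exact d₂ (C.disjoint' (by decide))
      | exact d₃ (C.disjoint' (by decide))
      | exact d₄ (C.disjoint' (by decide))
      | exact c₁ (C.disjoint (by decide))
      | exact c₃ (C.disjoint (by decide))
      | exact (C.disjoint (by decide)).mono_right hp₂
      | exact (C.disjoint (by decide)).mono_right hp₄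

end Config

/-- The thick edges of the core graph: two frames, on `0, …, 6` and on `7, …, 13`, and the fence
`14, 15, 16, 17`, connected by four edges. -/
def coreT : List (Fin 18 × Fin 18) :=
  [(0, 2), (2, 3), (3, 1), (0, 5), (5, 4), (4, 1), (6, 2), (6, 3), (6, 4), (6, 5),
    (7, 9), (9, 10), (10, 8), (7, 12), (12, 11), (11, 8), (13, 9), (13, 10), (13, 11), (13, 12),
    (14, 15), (15, 16), (16, 17), (17, 14), (0, 14), (1, 16), (7, 15), (8, 17)]

/-- The thin edges of the core graph. -/
def coreS : List (Fin 18 × Fin 18) :=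
  [(0, 1), (0, 3), (1, 2), (0, 4), (1, 5), (7, 8), (7, 10), (8, 9), (7, 11), (8, 12)]

namespace Config

set_option maxRecDepth 10000 in
theorem isEmpty_core : IsEmpty (Config coreT coreS) := ⟨fun C => by
  have h0 := (C.comap (T' := halfT) (S' := halfS) ![0, 1, 2, 3, 4, 5, 6, 14, 15, 16, 17]
    (by decide) (by decide) (by decide)).wind_fence
  have h7 := (C.comap (T' := halfT) (S' := halfS) ![7, 8, 9, 10, 11, 12, 13, 15, 16, 17, 14]
    (by decide) (by decide) (by decide)).wind_fence
  change ((C.arc 14 15).trans ((C.arc 15 16).trans ((C.arc 16 17).trans (C.arc 17 14)))).wind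
    (C.pos 0) = 0 at h0
  change ((C.arc 15 16).trans ((C.arc 16 17).trans ((C.arc 17 14).trans (C.arc 14 15)))).wind
    (C.pos 7) = 0 at h7
  have n : ∀ w, (w = 0 ∨ w = 7) → (C.pos w ∉ range (C.arc 14 15) ∧ C.pos w ∉ range (C.arc 15 16)) ∧
      (C.pos w ∉ range (C.arc 16 17) ∧ C.pos w ∉ range (C.arc 17 14)) := by
    rintro w (rfl | rfl) <;> refine ⟨⟨?_, ?_⟩, ⟨?_, ?_⟩⟩ <;> exact C.notMem (by decide)
  have n0 := n 0 (.inl rfl)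
  have n7 := n 7 (.inr rfl)
  rw [Path.wind_trans, Path.wind_trans, Path.wind_trans] at h0 h7
  · refine absurd (odd_wind_sub_wind (p₁₁ := C.arc 14 15) (p₁₂ := (C.arc 17 14).symm)
      (p₂₁ := (C.arc 15 16).symm) (p₂₂ := C.arc 16 17) (r₁ := C.arc 7 15)
      (r₂ := (C.arc 7 9).trans ((C.arc 9 10).trans ((C.arc 10 8).trans (C.arc 8 17))))
      (s₁ := (C.arc 0 14).symm) (s₂ := (C.arc 1 16).symm.trans ((C.arc 3 1).symm.trans
        ((C.arc 2 3).symm.trans (C.arc 0 2).symm)))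
      ?_ ?_ ?_ ?_ ?_ ?_ ?_ ?_ (Path.inter_eq_zero ?_) (Path.inter_eq_zero ?_)
      (Path.inter_eq_zero ?_) (Path.inter_eq_zero ?_) (Path.inter_eq_zero ?_)
      (Path.inter_eq_zero ?_) (Path.inter_eq_zero ?_) (Path.inter_eq_zero ?_)
      (Path.inter_eq_zero ?_) (Path.inter_eq_zero ?_) (Path.inter_eq_zero ?_)
      (Path.inter_eq_zero ?_) (Path.inter_eq_zero ?_) (Path.inter_eq_zero ?_)) ?_
    rotate_right
    · rintro ⟨n, hn⟩
      rw [Path.wind_symm _ n0.2.2, Path.wind_symm _ n7.2.2, Path.wind_symm _ n0.1.2,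
        Path.wind_symm _ n7.1.2] at hn
      have : (0 : ℂ) = 2 * n + 1 := by linear_combination hn + h0 - h7
      have : (0 : ℤ) = 2 * n + 1 := by exact_mod_cast this
      omega
    all_goals
      try simp only [Path.trans_range, Path.symm_range, disjoint_union_left, disjoint_union_right,
        mem_union, not_or, mem_insert_iff, mem_singleton_iff, forall_eq_or_imp, forall_eq]
      repeat' apply And.intro
      all_goals first
        | exact C.notMem (by decide)
        | exact C.disjoint (by decide)
  all_goals
    try simp only [Path.trans_range, mem_union, not_or]
    grind⟩

end Config

/-- The endpoints of the edges of the core graph. -/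
def coreEnds (k : Fin 38) : Fin 18 × Fin 18 := (coreT ++ coreS).get k

/-- The positions of the vertices of the core graph. -/
def corePos : Fin 18 → ℤ × ℤ :=
  ![(-20, 0), (20, 0), (-4, 4), (4, 4), (4, -4), (-4, -4), (0, 0),
    (40, 60), (80, 60), (56, 64), (64, 64), (64, 56), (56, 56), (60, 60),
    (-40, 0), (0, 40), (40, 0), (0, -40)]

/-- The bends of the edges of the core graph. -/
def coreBend (k : Fin 38) : ℤ × ℤ :=
  if k < 27 then (corePos (coreEnds k).1 + corePos (coreEnds k).2) / 2 else
  (![(120, 0), (0, 20), (-8, 8), (8, 8), (-8, -8), (8, -8), (60, 80), (52, 68), (68, 68), (52, 52),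
    (68, 52)] : Fin 11 → ℤ × ℤ) (Fin.ofNat 11 (k - 27))

/-- The direction in which the copies of a thick edge are spread at its bend. -/
def coreOff (k : Fin 38) : ℤ × ℤ := if k < 27 then (0, 1) else if k = 27 then (1, 0) else 0

/-- A half of an edge of the core graph: the part before the bend or the part after it. -/
abbrev Cell : Type := Fin 38 × Bool

namespace Cell

/-- The vertex of the core graph at the end of a cell. -/
def apex (c : Cell) : Fin 18 := bif c.2 then (coreEnds c.1).2 else (coreEnds c.1).1

def lin (f p : ℤ × ℤ) : ℤ := f.1 * p.1 + f.2 * p.2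

/-- The linear functional `f` separates two cells, except for a common apex. -/
def Sep (f : ℤ × ℤ) (c d : Cell) : Bool :=
  let a := lin f (corePos c.apex)
  let m := lin f (coreBend c.1)
  let m' := m + lin f (coreOff c.1)
  let b := lin f (corePos d.apex)
  let n := lin f (coreBend d.1)
  let n' := n + lin f (coreOff d.1)
  bif c.apex == d.apex then m < a && m' < a && b < n && b < n' else
    a < b && m < b && m' < b && a < n && m < n && m' < n && a < n' && m < n' && m' < n'

/-- The pairs of cells that cross. -/
def crossing : Fin 4 → Cell × Cell :=
  ![((29, true), (30, true)), ((31, true), (32, true)), ((34, true), (35, true)),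
    ((36, true), (37, true))]

set_option maxRecDepth 100000 in
theorem exists_sep : ∀ k k' : Fin 38, k < k' → ∀ s s' : Bool,
    (∃ i, crossing i = ((k, s), (k', s'))) ∨
    ∃ f ∈ ([(2, 5), (2, -5), (2, -1), (2, -7), (2, 7), (3, 4), (0, 1), (3, -4)] : List (ℤ × ℤ)),
      Sep f (k, s) (k', s') || Sep f (k', s') (k, s) := by
  decide +kernel

end Cell

namespace Cell

/-- The points of a cell: `t` is the parameter on the segment from the apex to the bend of the copy
with index `l`. -/
def pt (c : Cell) (l t : ℝ) : Plane :=
  ((1 - t) * (corePos c.apex).1 + t * ((coreBend c.1).1 + l * (coreOff c.1).1),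
    (1 - t) * (corePos c.apex).2 + t * ((coreBend c.1).2 + l * (coreOff c.1).2))

def linR (f : ℤ × ℤ) (p : Plane) : ℝ := f.1 * p.1 + f.2 * p.2

theorem linR_pt (f : ℤ × ℤ) (c : Cell) (l t : ℝ) : linR f (c.pt l t) =
    (1 - t) * (lin f (corePos c.apex) : ℤ) + t * ((1 - l) * (lin f (coreBend c.1) : ℤ) +
      l * ((lin f (coreBend c.1) + lin f (coreOff c.1) : ℤ) : ℝ)) := by
  simp only [linR, pt, lin]
  push_cast
  ring

theorem comb_lt {a b x t : ℝ} (ht : t ∈ I) (ha : a < x) (hb : b < x) :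
    (1 - t) * a + t * b < x := by
  rcases eq_or_lt_of_le ht.1 with rfl | h
  · linarith
  · nlinarith [ht.2]

theorem lt_comb {a b x t : ℝ} (ht : t ∈ I) (ha : x < a) (hb : x < b) :
    x < (1 - t) * a + t * b := by
  rcases eq_or_lt_of_le ht.1 with rfl | h
  · linarith
  · nlinarith [ht.2]

theorem eq_zero_of_sep {f : ℤ × ℤ} {c d : Cell} (h : Sep f c d = true) {l t l' t' : ℝ}
    (hl : l ∈ I) (ht : t ∈ I) (hl' : l' ∈ I) (ht' : t' ∈ I) (he : c.pt l t = d.pt l' t') :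
    t = 0 ∧ t' = 0 ∧ c.apex = d.apex := by
  have he' := congrArg (linR f) he
  rw [linR_pt, linR_pt] at he'
  simp only [Sep, cond_eq_ite, beq_iff_eq] at h
  split_ifs at h with ha
  · rw [ha] at he' h
    simp only [Bool.and_eq_true, decide_eq_true_eq] at h
    obtain ⟨⟨⟨h1, h2⟩, h3⟩, h4⟩ := h
    have e1 := comb_lt hl (Int.cast_lt (R := ℝ).2 h1) (Int.cast_lt (R := ℝ).2 h2)
    have e2 := lt_comb hl' (Int.cast_lt (R := ℝ).2 h3) (Int.cast_lt (R := ℝ).2 h4)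
    refine ⟨?_, ?_, ha⟩ <;> nlinarith [ht.1, ht'.1]
  · exfalso
    simp only [Bool.and_eq_true, decide_eq_true_eq] at h
    obtain ⟨⟨⟨⟨⟨⟨⟨⟨h1, h2⟩, h3⟩, h4⟩, h5⟩, h6⟩, h7⟩, h8⟩, h9⟩ := h
    refine absurd he' (ne_of_lt (comb_lt ht (lt_comb ht' ?_ (lt_comb hl' ?_ ?_))
      (comb_lt hl (lt_comb ht' ?_ (lt_comb hl' ?_ ?_))
        (lt_comb ht' ?_ (lt_comb hl' ?_ ?_))))) <;> exact Int.cast_lt.2 (by assumption)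

/-- Cells of different edges that do not cross meet only in a common apex. -/
theorem eq_zero_of_ne {c d : Cell} (h : c.1 ≠ d.1)
    (hx : ∀ i, crossing i ≠ (c, d) ∧ crossing i ≠ (d, c)) {l t l' t' : ℝ}
    (hl : l ∈ I) (ht : t ∈ I) (hl' : l' ∈ I) (ht' : t' ∈ I) (he : c.pt l t = d.pt l' t') :
    t = 0 ∧ t' = 0 ∧ c.apex = d.apex := by
  have main : (∃ f, Sep f c d || Sep f d c) →
      t = 0 ∧ t' = 0 ∧ c.apex = d.apex := by
    rintro ⟨f, hf⟩
    rcases Bool.or_eq_true_iff.1 hf with hf | hf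
    · exact eq_zero_of_sep hf hl ht hl' ht' he
    · obtain ⟨h1, h2, h3⟩ := eq_zero_of_sep hf hl' ht' hl ht he.symm
      exact ⟨h2, h1, h3.symm⟩
  refine main ?_
  rcases lt_or_gt_of_ne h with h | h
  · rcases exists_sep _ _ h c.2 d.2 with ⟨i, hi⟩ | ⟨f, -, hf⟩
    · exact absurd hi (hx i).1
    · exact ⟨f, hf⟩
  · rcases exists_sep _ _ h d.2 c.2 with ⟨i, hi⟩ | ⟨f, -, hf⟩
    · exact absurd hi (hx i).2
    · exact ⟨f, by rwa [Bool.or_comm]⟩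

def det (u v : ℤ × ℤ) : ℤ := u.1 * v.2 - u.2 * v.1

theorem thick_cert : ∀ k : Fin 38, k < 28 →
    det (coreOff k) (corePos (apex (k, false)) - coreBend k) *
      det (coreOff k) (corePos (apex (k, true)) - coreBend k) < 0 ∧
    ∀ s, 0 < ((coreBend k).1 - (corePos (apex (k, s))).1) *
      ((coreBend k).1 + (coreOff k).1 - (corePos (apex (k, s))).1) := by
  decide +kernel

theorem thin_cert : ∀ k : Fin 38, 28 ≤ k → coreOff k = 0 ∧
    0 < ((coreBend k).1 - (corePos (apex (k, false))).1) *
      ((corePos (apex (k, true))).1 - (coreBend k).1) := by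
  decide +kernel

theorem exists_thick : ∀ (v : Fin 18) (k : Fin 38), ∃ c : Cell,
    c.1 < 28 ∧ c.1 ≠ k ∧ c.apex = v := by
  decide +kernel

theorem crossing_cert : ∀ i, 28 ≤ (crossing i).1.1 ∧ 28 ≤ (crossing i).2.1 ∧
    (crossing i).1.1 ≠ (crossing i).2.1 ∧
    det (coreBend (crossing i).1.1 - corePos (crossing i).1.apex)
      (coreBend (crossing i).2.1 - corePos (crossing i).2.apex) ≠ 0 := by
  decide +kernel

/-- Two copies of a thick edge meet only at the ends. -/
theorem eq_of_thick {k : Fin 38} (hk : k < 28) {s s' : Bool} {l t l' t' : ℝ} (ht : t ∈ I)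
    (ht' : t' ∈ I) (he : pt (k, s) l t = pt (k, s') l' t') :
    (s = s' ∧ t = t' ∨ s ≠ s' ∧ t = 1 ∧ t' = 1) ∧ (t = 0 ∨ l = l') := by
  obtain ⟨h, -⟩ := thick_cert k hk
  have h1 := congrArg Prod.fst he
  have h2 := congrArg Prod.snd he
  have hg : ∀ s, ((det (coreOff k) (corePos (apex (k, s)) - coreBend k) : ℤ) : ℝ) =
      (coreOff k).1 * ((corePos (apex (k, s))).2 - (coreBend k).2) -
      (coreOff k).2 * ((corePos (apex (k, s))).1 - (coreBend k).1) := by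
    intro s
    simp only [det, Prod.fst_sub, Prod.snd_sub]
    push_cast
    ring
  have key : (1 - t) * ((det (coreOff k) (corePos (apex (k, s)) - coreBend k) : ℤ) : ℝ) =
      (1 - t') * ((det (coreOff k) (corePos (apex (k, s')) - coreBend k) : ℤ) : ℝ) := by
    rw [hg, hg]
    simp only [pt] at h1 h2
    linear_combination (coreOff k).1 * h2 - (coreOff k).2 * h1
  have hA : (s = s' ∧ t = t' ∨ s ≠ s' ∧ t = 1 ∧ t' = 1) := by
    have h' : ((det (coreOff k) (corePos (apex (k, false)) - coreBend k) : ℤ) : ℝ) *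
      ((det (coreOff k) (corePos (apex (k, true)) - coreBend k) : ℤ) : ℝ) < 0 := by exact_mod_cast h
    by_cases hs : s = s'
    · subst hs
      refine .inl ⟨rfl, ?_⟩
      have : ((det (coreOff k) (corePos (apex (k, s)) - coreBend k) : ℤ) : ℝ) ≠ 0 := by
        cases s
        · exact left_ne_zero_of_mul h'.ne
        · exact right_ne_zero_of_mul h'.ne
      linarith [mul_right_cancel₀ this key]
    · refine .inr ⟨hs, ?_⟩
      have aux : ∀ a b : ℝ, a * b < 0 → (1 - t) * a = (1 - t') * b → t = 1 ∧ t' = 1 := by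
        intro a b hab e
        have ha := left_ne_zero_of_mul hab.ne
        have e1 : (1 - t) * (a * a) = (1 - t') * (a * b) := by linear_combination a * e
        have e2 : 0 ≤ (1 - t) * (a * a) := mul_nonneg (by linarith [ht.2]) (mul_self_nonneg a)
        have e3 : (1 - t') * (a * b) ≤ 0 :=
          mul_nonpos_of_nonneg_of_nonpos (by linarith [ht'.2]) hab.le
        have e4 : (1 - t) * (a * a) = 0 := by linarith
        have e5 : (1 - t') * (a * b) = 0 := by linarith
        constructor
        · have := (mul_eq_zero.1 e4).resolve_right (mul_self_ne_zero.2 ha); linarith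
        · have := (mul_eq_zero.1 e5).resolve_right hab.ne; linarith
      cases s <;> cases s'
      · exact absurd rfl hs
      · exact aux _ _ h' key
      · exact aux _ _ (by rwa [mul_comm]) key
      · exact absurd rfl hs
  refine ⟨hA, or_iff_not_imp_left.2 fun ht0 => ?_⟩
  have h3 : t * ((l - l') * (coreOff k).1) = 0 ∧ t * ((l - l') * (coreOff k).2) = 0 := by
    simp only [pt] at h1 h2
    rcases hA with ⟨rfl, rfl⟩ | ⟨-, rfl, rfl⟩
    · constructor
      · linear_combination h1
      · linear_combination h2
    · constructor
      · linear_combination h1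
      · linear_combination h2
  by_contra hll
  have hll' : l - l' ≠ 0 := sub_ne_zero.2 hll
  have h4 : (coreOff k).1 = 0 := by
    simpa [ht0, hll'] using h3.1
  have h5 : (coreOff k).2 = 0 := by
    simpa [ht0, hll'] using h3.2
  simp [det, h4, h5] at h

/-- Crossing cells have at most one common point. -/
theorem crossing_unique (i : Fin 4) {t t' r r' l l' m m' : ℝ}
    (h : (crossing i).1.pt l t = (crossing i).2.pt l' t')
    (h' : (crossing i).1.pt m r = (crossing i).2.pt m' r') :
    (crossing i).1.pt l t = (crossing i).1.pt m r := by
  obtain ⟨h1, h2, -, hd⟩ := crossing_cert i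
  have hd' : (((det (coreBend (crossing i).1.1 - corePos (crossing i).1.apex)
      (coreBend (crossing i).2.1 - corePos (crossing i).2.apex)) : ℤ) : ℝ) ≠ 0 := by
    exact_mod_cast hd
  have hx := congrArg Prod.fst h
  have hy := congrArg Prod.snd h
  have hx' := congrArg Prod.fst h'
  have hy' := congrArg Prod.snd h'
  simp only [pt, (thin_cert _ h1).1, (thin_cert _ h2).1, det, Prod.fst_sub, Prod.snd_sub,
    Prod.fst_zero, Prod.snd_zero, Int.cast_zero, mul_zero, add_zero] at *
  push_cast at hd'
  have : t = r := by
    rw [← sub_eq_zero]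
    refine (mul_eq_zero.1 ?_).resolve_right hd'
    linear_combination
      ((coreBend (crossing i).2.1).2 - (corePos (crossing i).2.apex).2) * (hx - hx')
      - ((coreBend (crossing i).2.1).1 - (corePos (crossing i).2.apex).1) * (hy - hy')
  rw [this]

theorem pt_zero (c : Cell) (l : ℝ) :
    c.pt l 0 = (((corePos c.apex).1 : ℝ), ((corePos c.apex).2 : ℝ)) := by
  simp [pt]

theorem pt_one (k : Fin 38) (s s' : Bool) (l : ℝ) : pt (k, s) l 1 = pt (k, s') l 1 := by
  simp [pt]

theorem pt_fst (c : Cell) (l t : ℝ) : (c.pt l t).1 = (corePos c.apex).1 +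
    t * ((1 - l) * ((coreBend c.1).1 - (corePos c.apex).1) +
      l * ((coreBend c.1).1 + (coreOff c.1).1 - (corePos c.apex).1)) := by
  simp only [pt]; ring

theorem pt_fst_injective {c : Cell} (hc : c.1 < 28) {l t t' : ℝ} (hl : l ∈ I)
    (h : (c.pt l t).1 = (c.pt l t').1) : t = t' := by
  have h' : (0 : ℝ) < ((coreBend c.1).1 - (corePos c.apex).1) *
      ((coreBend c.1).1 + (coreOff c.1).1 - (corePos c.apex).1) := by
    exact_mod_cast (thick_cert c.1 hc).2 c.2
  rw [pt_fst, pt_fst, add_right_inj] at h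
  refine mul_right_cancel₀ (fun h0 => ?_) h
  rcases mul_pos_iff.1 h' with ⟨h1, h2⟩ | ⟨h1, h2⟩
  · exact absurd h0 (lt_comb hl h1 h2).ne'
  · exact absurd h0 (comb_lt hl h1 h2).ne

end Cell

/-- The simple graph with a given indexed family of edges. -/
def edgeGraph {ι W : Type*} (ends : ι → W × W) : SimpleGraph W :=
  SimpleGraph.fromEdgeSet (range fun i => s((ends i).1, (ends i).2))

def edgeEquiv {ι W : Type*} {ends : ι → W × W}
    (hinj : Function.Injective fun i => s((ends i).1, (ends i).2))
    (hne : ∀ i, (ends i).1 ≠ (ends i).2) : ι ≃ (edgeGraph ends).edgeSet :=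
  Equiv.ofBijective (fun i => ⟨s((ends i).1, (ends i).2), by
    rw [edgeGraph, SimpleGraph.edgeSet_fromEdgeSet]
    exact ⟨⟨i, rfl⟩, hne i⟩⟩)
    ⟨fun i j h => hinj (congrArg Subtype.val h), by
      rintro ⟨e, he⟩
      rw [edgeGraph, SimpleGraph.edgeSet_fromEdgeSet] at he
      obtain ⟨⟨i, rfl⟩, -⟩ := he
      exact ⟨i, rfl⟩⟩

/-- The drawing given by an indexed family of arcs. -/
def Drawing.ofArcs {ι W : Type*} {ends : ι → W × W}
    (hinj : Function.Injective fun i => s((ends i).1, (ends i).2))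
    (hne : ∀ i, (ends i).1 ≠ (ends i).2) (P : W → Plane) (A : ι → ℝ → Plane)
    (hP : Function.Injective P) (hc : ∀ i, Continuous (A i)) (hA : ∀ i, InjOn (A i) (Icc 0 1))
    (h0 : ∀ i, A i 0 = P (ends i).1) (h1 : ∀ i, A i 1 = P (ends i).2)
    (ha : ∀ i, ∀ t ∈ Icc (0 : ℝ) 1, ∀ v, A i t = P v → t = 0 ∨ t = 1) :
    Drawing (edgeGraph ends) where
  vert := P
  vert_inj := hP
  arc e := A ((edgeEquiv hinj hne).symm e)
  arc_cont e := (hc _).continuousOn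
  arc_injOn e := hA _
  arc_ends e := by
    obtain ⟨i, rfl⟩ := (edgeEquiv hinj hne).surjective e
    rw [Equiv.symm_apply_apply]
    exact ⟨_, _, rfl, h0 i, h1 i⟩
  arc_avoid e t ht := by
    rintro ⟨v, hv⟩
    exact ha _ t ht v hv

/-- The vertices of the graph in which every thick edge of the core graph is replaced by `N` paths
of length two. -/
abbrev ThickV (N : ℕ) : Type := Fin 18 ⊕ Fin 28 × Fin N

abbrev ThickE (N : ℕ) : Type := (Fin 28 × Fin N) × Bool ⊕ Fin 10

def thickK (k : Fin 28) : Fin 38 := Fin.castLE (by decide) k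

def thinK (j : Fin 10) : Fin 38 := Fin.natAdd 28 j

def thickEnds (N : ℕ) : ThickE N → ThickV N × ThickV N
  | .inl (x, s) => (.inl (Cell.apex (thickK x.1, s)), .inr x)
  | .inr j => (.inl (Cell.apex (thinK j, false)), .inl (Cell.apex (thinK j, true)))

theorem apex_ne : ∀ k, Cell.apex (k, false) ≠ Cell.apex (k, true) := by decide

theorem thin_inj : ∀ j j' : Fin 10,
    s(Cell.apex (thinK j, false), Cell.apex (thinK j, true)) =
      s(Cell.apex (thinK j', false), Cell.apex (thinK j', true)) → j = j' := by
  decide +kernel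

section

variable {N : ℕ} {W : Type*} {φ : ThickV N → W}

theorem thickEnds_ne (hφ : Function.Injective φ) (i : ThickE N) :
    (Prod.map φ φ (thickEnds N i)).1 ≠ (Prod.map φ φ (thickEnds N i)).2 := by
  refine hφ.ne ?_
  rcases i with ⟨x, s⟩ | j
  · exact Sum.inl_ne_inr
  · exact fun h => apex_ne _ (Sum.inl_injective h)

theorem thickEnds_injective (hφ : Function.Injective φ) : Function.Injective fun i : ThickE N =>
    s((Prod.map φ φ (thickEnds N i)).1, (Prod.map φ φ (thickEnds N i)).2) := by
  have : (fun i : ThickE N =>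
      s((Prod.map φ φ (thickEnds N i)).1, (Prod.map φ φ (thickEnds N i)).2)) =
      Sym2.map φ ∘ fun i => s((thickEnds N i).1, (thickEnds N i).2) := rfl
  rw [this]
  refine (Sym2.map.injective hφ).comp ?_
  rintro (⟨x, s⟩ | j) (⟨x', s'⟩ | j') h
  · have h' := Sym2.eq_iff.1 h
    simp only [thickEnds, Sum.inl.injEq, Sum.inr.injEq, reduceCtorEq, and_false, or_false] at h'
    obtain ⟨h1, rfl⟩ := h'
    have : s = s' := by
      cases s <;> cases s'
      exacts [rfl, absurd h1 (apex_ne _), absurd h1.symm (apex_ne _), rfl]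
    rw [this]
  · have h' := Sym2.eq_iff.1 h
    simp [thickEnds] at h'
  · have h' := Sym2.eq_iff.1 h
    simp [thickEnds] at h'
  · have h' := Sym2.eq_iff.1 h
    simp only [thickEnds, Sum.inl.injEq] at h'
    rw [thin_inj j j' (Sym2.eq_iff.2 h')]

end

/-- The graph in which every thick edge of the core graph is replaced by `N` paths of length two. -/
def thickGraph {N : ℕ} {W : Type*} (φ : ThickV N → W) : SimpleGraph W :=
  edgeGraph fun i => Prod.map φ φ (thickEnds N i)

namespace Thick

variable {N : ℕ}

def par (i : Fin N) : ℝ := i / N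

theorem par_mem (i : Fin N) : par i ∈ I := by
  have h : (i : ℝ) < N := by exact_mod_cast i.2
  have h0 : (0 : ℝ) ≤ i := Nat.cast_nonneg _
  exact ⟨by unfold par; positivity, div_le_one_of_le₀ h.le (by positivity)⟩

theorem par_injective : Function.Injective (par (N := N)) := by
  intro i j h
  have hN : (N : ℝ) ≠ 0 := by exact_mod_cast (Fin.pos i).ne'
  have := (div_left_inj' hN).1 h
  exact Fin.ext (by exact_mod_cast this)

/-- The positions of the vertices in the monotone drawing. -/
def pos : ThickV N → Plane
  | .inl v => ((corePos v).1, (corePos v).2)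
  | .inr x => Cell.pt (thickK x.1, false) (par x.2) 1

/-- The edges of the monotone drawing. -/
def arc : ThickE N → ℝ → Plane
  | .inl (x, s), t => Cell.pt (thickK x.1, s) (par x.2) t
  | .inr j, t => if t ≤ 1 / 2 then Cell.pt (thinK j, false) 0 (2 * t) else
      Cell.pt (thinK j, true) 0 (2 - 2 * t)

def core : ThickE N → Fin 38
  | .inl (x, _) => thickK x.1
  | .inr j => thinK j

def parE : ThickE N → ℝ
  | .inl (x, _) => par x.2
  | .inr _ => 0

theorem parE_mem (e : ThickE N) : parE e ∈ I := by
  rcases e with ⟨x, s⟩ | j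
  · exact par_mem _
  · exact ⟨le_rfl, zero_le_one⟩

theorem thickK_lt (k : Fin 28) : thickK k < 28 := k.2

theorem le_thinK (j : Fin 10) : 28 ≤ thinK j := Nat.le_add_right 28 j

theorem thickK_injective : Function.Injective thickK := Fin.castLE_injective (by decide)

theorem thinK_injective : Function.Injective thinK := Fin.natAdd_injective _ _

theorem eq_of_core_eq {e f : ThickE N} (he : 28 ≤ core e) (h : core e = core f) : e = f := by
  rcases e with ⟨x, s⟩ | j
  · exact absurd he (not_le.2 (thickK_lt x.1))
  rcases f with ⟨y, s⟩ | j'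
  · rw [h] at he
    exact absurd he (not_le.2 (thickK_lt y.1))
  · rw [thinK_injective h]

theorem exists_pt (e : ThickE N) {t : ℝ} (ht : t ∈ I) : ∃ s, ∃ τ ∈ I,
    arc e t = Cell.pt (core e, s) (parE e) τ ∧ (τ = 0 → t = 0 ∨ t = 1) ∧
    ∀ x s', e = .inl (x, s') → s = s' ∧ τ = t := by
  rcases e with ⟨x, s⟩ | j
  · exact ⟨s, t, ht, rfl, .inl, fun _ _ h => by cases h; exact ⟨rfl, rfl⟩⟩
  · by_cases h : t ≤ 1 / 2
    · exact ⟨false, 2 * t, ⟨by linarith [ht.1], by linarith⟩, if_pos h, fun h => .inl (by linarith),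
        fun _ _ h => by cases h⟩
    · exact ⟨true, 2 - 2 * t, ⟨by linarith [ht.2], by linarith⟩, if_neg h,
        fun h => .inr (by linarith), fun _ _ h => by cases h⟩

theorem crossing_ne_of_lt {c d : Cell} (hc : c.1 < 28) (i : Fin 4) :
    Cell.crossing i ≠ (d, c) ∧ Cell.crossing i ≠ (c, d) := by
  obtain ⟨h1, h2, -⟩ := Cell.crossing_cert i
  constructor <;> intro h
  · rw [h] at h2
    exact not_le.2 hc h2
  · rw [h] at h1
    exact not_le.2 hc h1

theorem corePos_injective : Function.Injective corePos := by decide +kernel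

/-- A cell does not contain the vertices of the core graph other than its apex. -/
theorem eq_zero_of_pt_eq (v : Fin 18) {c : Cell} {l t : ℝ} (hl : l ∈ I) (ht : t ∈ I)
    (h : c.pt l t = pos (N := N) (.inl v)) : t = 0 := by
  obtain ⟨d, hd, hne, rfl⟩ := Cell.exists_thick v c.1
  have h' : c.pt l t = d.pt 0 0 := by rw [h, Cell.pt_zero]; rfl
  exact (Cell.eq_zero_of_ne hne.symm (crossing_ne_of_lt hd) hl ht unitInterval.zero_mem
    unitInterval.zero_mem h').1

theorem pos_injective : Function.Injective (pos (N := N)) := by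
  rintro (v | x) (w | y) h
  · have h1 := congrArg Prod.fst h
    have h2 := congrArg Prod.snd h
    simp only [pos, Int.cast_inj] at h1 h2
    rw [corePos_injective (Prod.ext h1 h2)]
  · exact absurd (eq_zero_of_pt_eq v (par_mem _) unitInterval.one_mem h.symm) one_ne_zero
  · exact absurd (eq_zero_of_pt_eq w (par_mem _) unitInterval.one_mem h) one_ne_zero
  · by_cases hk : x.1 = y.1
    · obtain ⟨k, i⟩ := x
      obtain ⟨k', j⟩ := y
      cases hk
      have := (Cell.eq_of_thick (thickK_lt k) unitInterval.one_mem unitInterval.one_mem h).2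
      rw [show i = j from par_injective (this.resolve_left one_ne_zero)]
    · exact absurd (Cell.eq_zero_of_ne (thickK_injective.ne hk) (crossing_ne_of_lt (thickK_lt y.1))
        (par_mem _) unitInterval.one_mem (par_mem _) unitInterval.one_mem h).1 one_ne_zero

theorem arc_avoid (e : ThickE N) {t : ℝ} (ht : t ∈ I) (v : ThickV N) (h : arc e t = pos v) :
    t = 0 ∨ t = 1 := by
  obtain ⟨s, τ, hτ, he, h0, hx⟩ := exists_pt e ht
  rw [he] at h
  rcases v with v | y
  · exact h0 (eq_zero_of_pt_eq v (parE_mem e) hτ h)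
  · by_cases hk : core e = thickK y.1
    · rcases e with ⟨x, s'⟩ | j
      · obtain ⟨rfl, rfl⟩ := hx _ _ rfl
        change Cell.pt (thickK x.1, _) _ _ = Cell.pt (thickK y.1, false) _ _ at h
        rw [← show thickK x.1 = thickK y.1 from hk] at h
        rcases (Cell.eq_of_thick (thickK_lt x.1) hτ unitInterval.one_mem h).1 with h | h
        exacts [.inr h.2, .inr h.2.1]
      · exact absurd (le_thinK j) (not_le.2 (lt_of_eq_of_lt hk (thickK_lt y.1)))
    · exact absurd (Cell.eq_zero_of_ne hk (crossing_ne_of_lt (thickK_lt y.1)) (parE_mem e) hτ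
        (par_mem _) unitInterval.one_mem h).2.1 one_ne_zero

theorem arc_fst_injOn (e : ThickE N) : InjOn (fun t => (arc e t).1) (Icc 0 1) := by
  intro t ht t' ht' h
  rcases e with ⟨x, s⟩ | j
  · exact Cell.pt_fst_injective (thickK_lt x.1) (par_mem _) h
  · obtain ⟨h0, h1⟩ := Cell.thin_cert (thinK j) (le_thinK j)
    have h1' : (0 : ℝ) < ((coreBend (thinK j)).1 - (corePos (Cell.apex (thinK j, false))).1) *
      ((corePos (Cell.apex (thinK j, true))).1 - (coreBend (thinK j)).1) := by exact_mod_cast h1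
    simp only [arc] at h
    rcases mul_pos_iff.1 h1' with ⟨h2, h3⟩ | ⟨h2, h3⟩
    all_goals
      split_ifs at h with hA hB hB <;>
        simp only [Cell.pt_fst, h0, Prod.fst_zero, Int.cast_zero] at h
      all_goals nlinarith

theorem arc_continuous (e : ThickE N) : Continuous (arc e) := by
  have hpt : ∀ (c : Cell) (l : ℝ), Continuous (c.pt l) := fun c l => by
    unfold Cell.pt
    fun_prop
  rcases e with ⟨x, s⟩ | j
  · exact hpt _ _
  · refine Continuous.if_le ((hpt _ _).comp (by fun_prop)) ((hpt _ _).comp (by fun_prop))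
      continuous_id continuous_const ?_
    rintro t rfl
    norm_num
    exact Cell.pt_one _ _ _ _

variable {W : Type*} (φ : ThickV N ≃ W)

/-- The monotone drawing of the graph. -/
def drawing : Drawing (thickGraph φ) :=
  Drawing.ofArcs (thickEnds_injective φ.injective) (thickEnds_ne φ.injective) (pos ∘ φ.symm) arc
    (pos_injective.comp φ.symm.injective) arc_continuous
    (fun e t ht t' ht' h => arc_fst_injOn e ht ht' (congrArg Prod.fst h))
    (fun e => by
      rcases e with ⟨x, s⟩ | j
      · simp [thickEnds, arc, pos, Cell.pt_zero]
      · simp [thickEnds, arc, pos, Cell.pt_zero])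
    (fun e => by
      rcases e with ⟨x, s⟩ | j
      · simp only [thickEnds, arc, pos, Prod.map_snd, Function.comp, Equiv.symm_apply_apply]
        exact Cell.pt_one _ _ _ _
      · simp only [thickEnds, arc, pos, Prod.map_snd, Function.comp, Equiv.symm_apply_apply]
        norm_num [Cell.pt_zero])
    fun e t ht v h => arc_avoid e ht _ h

theorem drawing_isMonotone : (drawing φ).IsMonotone := fun _ => arc_fst_injOn _

theorem exists_crossing {e f : ThickE N} (hne : e ≠ f) {t t' : ℝ} (ht : t ∈ Ioo (0 : ℝ) 1)
    (ht' : t' ∈ Ioo (0 : ℝ) 1) (h : arc e t = arc f t') :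
    ∃ i s s', (Cell.crossing i = ((core e, s), (core f, s')) ∨
      Cell.crossing i = ((core f, s'), (core e, s))) ∧
      (∃ τ, arc e t = Cell.pt (core e, s) 0 τ) ∧ ∃ τ, arc e t = Cell.pt (core f, s') 0 τ := by
  obtain ⟨s, τ, hτ, he, h0, hx⟩ := exists_pt e ⟨ht.1.le, ht.2.le⟩
  obtain ⟨s', τ', hτ', hf, h0', hx'⟩ := exists_pt f ⟨ht'.1.le, ht'.2.le⟩
  have hτ0 : τ ≠ 0 := fun h => (h0 h).elim ht.1.ne' ht.2.ne
  have heq : Cell.pt (core e, s) (parE e) τ = Cell.pt (core f, s') (parE f) τ' := by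
    rw [← he, ← hf, h]
  have hcore : core e ≠ core f := by
    intro hc
    rcases e with ⟨x, u⟩ | j
    · rcases f with ⟨y, u'⟩ | j
      · obtain ⟨rfl, rfl⟩ := hx _ _ rfl
        obtain ⟨rfl, rfl⟩ := hx' _ _ rfl
        rw [← hc] at heq
        obtain ⟨h1, h2⟩ := Cell.eq_of_thick (thickK_lt x.1) hτ hτ' heq
        rcases h1 with ⟨rfl, -⟩ | ⟨-, h1, -⟩
        · exact hne (by rw [show x = y from
            Prod.ext (thickK_injective hc) (par_injective (h2.resolve_left hτ0))])
        · exact ht.2.ne h1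
      · exact hne (eq_of_core_eq (e := .inr j) (le_thinK j) hc.symm).symm
    · exact hne (eq_of_core_eq (le_thinK j) hc)
  by_cases hcr : ∃ i, Cell.crossing i = ((core e, s), (core f, s')) ∨
      Cell.crossing i = ((core f, s'), (core e, s))
  · obtain ⟨i, hi⟩ := hcr
    have h28 : 28 ≤ core e ∧ 28 ≤ core f := by
      obtain ⟨h1, h2, -⟩ := Cell.crossing_cert i
      rcases hi with hi | hi <;> rw [hi] at h1 h2
      exacts [⟨h1, h2⟩, ⟨h2, h1⟩]
    have hp : ∀ g : ThickE N, 28 ≤ core g → parE g = 0 := by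
      rintro (⟨x, u⟩ | j) hg
      · exact absurd hg (not_le.2 (thickK_lt x.1))
      · rfl
    rw [hp e h28.1] at he
    rw [hp f h28.2, ← h] at hf
    exact ⟨i, s, s', hi, ⟨τ, he⟩, ⟨τ', hf⟩⟩
  · push Not at hcr
    exact absurd (Cell.eq_zero_of_ne hcore hcr (parE_mem e) hτ (parE_mem f) hτ' heq).1 hτ0

theorem drawing_crossSet :
    (drawing φ).CrossSet.Finite ∧ (drawing φ).CrossSet.ncard ≤ 4 := by
  let E := edgeEquiv (thickEnds_injective φ.injective) (thickEnds_ne φ.injective)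
  let S : Fin 4 → Set (Plane × Sym2 (thickGraph φ).edgeSet) := fun i =>
    {x | ∃ e f : ThickE N, x.2 = s(E e, E f) ∧ core e = (Cell.crossing i).1.1 ∧
      core f = (Cell.crossing i).2.1 ∧ (∃ τ, x.1 = (Cell.crossing i).1.pt 0 τ) ∧
      ∃ τ, x.1 = (Cell.crossing i).2.pt 0 τ}
  have hS : ∀ i, (S i).Subsingleton := by
    rintro i ⟨z, p⟩ ⟨e, f, h1, h2, h3, ⟨τ, h4⟩, ⟨τ', h5⟩⟩
      ⟨z', p'⟩ ⟨e', f', h1', h2', h3', ⟨r, h4'⟩, ⟨r', h5'⟩⟩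
    obtain ⟨g1, g2, -⟩ := Cell.crossing_cert i
    dsimp only at h1 h4 h5 h1' h4' h5'
    have e1 := eq_of_core_eq (h2 ▸ g1) (h2.trans h2'.symm)
    have e2 := eq_of_core_eq (h3 ▸ g2) (h3.trans h3'.symm)
    subst e1 e2
    rw [h1, h1', h4, h4', Cell.crossing_unique i (h4.symm.trans h5) (h4'.symm.trans h5')]
  have hsub : (drawing φ).CrossSet ⊆ ⋃ i, S i := by
    rintro ⟨z, p⟩ ⟨e, f, hne, rfl, ⟨t, ht, rfl⟩, ⟨t', ht', h⟩⟩
    obtain ⟨e, rfl⟩ := E.surjective e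
    obtain ⟨f, rfl⟩ := E.surjective f
    change arc (E.symm (E f)) t' = arc (E.symm (E e)) t at h
    change (arc (E.symm (E e)) t, _) ∈ _
    rw [Equiv.symm_apply_apply] at *
    rw [Equiv.symm_apply_apply] at h
    obtain ⟨i, s, s', hi, h1, h2⟩ := exists_crossing (fun h => hne (congrArg E h)) ht ht' h.symm
    refine mem_iUnion.2 ⟨i, ?_⟩
    rcases hi with hi | hi
    · exact ⟨e, f, rfl, by rw [hi], by rw [hi], by rw [hi]; exact h1, by rw [hi]; exact h2⟩
    · exact ⟨f, e, Sym2.eq_swap, by rw [hi], by rw [hi], by rw [hi]; exact h2, by rw [hi]; exact h1⟩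
  have hfin : (⋃ i, S i).Finite := finite_iUnion fun i => (hS i).finite
  refine ⟨hfin.subset hsub, (ncard_le_ncard hsub hfin).trans ?_⟩
  calc (⋃ i, S i).ncard ≤ ∑ i, (S i).ncard := ncard_iUnion_le_of_fintype _
    _ ≤ ∑ _i : Fin 4, 1 := Finset.sum_le_sum fun i _ => by
      rw [ncard_le_one (hS i).finite]
      exact fun a ha b hb => hS i ha hb
    _ = 4 := rfl

end Thick

namespace RP2

/-- The projective completion of the line `y = s * x - p`. -/
def line (s p : ℝ) : Set RP2 := {q | ∃ v, mk v = q ∧ v.1 1 = s * v.1 0 - p * v.1 2}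

theorem mk_mem_line {s p : ℝ} {v : {v : Fin 3 → ℝ // v ≠ 0}} :
    mk v ∈ line s p ↔ v.1 1 = s * v.1 0 - p * v.1 2 := by
  refine ⟨?_, fun h => ⟨v, rfl, h⟩⟩
  rintro ⟨w, hw, h⟩
  obtain ⟨c, -, h'⟩ := mk_eq_mk.1 hw
  rw [← h']
  simp only [Pi.smul_apply, smul_eq_mul]
  linear_combination c * h

theorem planeToRP2_mem_line {s p : ℝ} {z : Plane} :
    planeToRP2 z ∈ line s p ↔ z.2 = s * z.1 - p := by
  change mk _ ∈ _ ↔ _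
  rw [mk_mem_line]
  simp

theorem planeToRP2_injective : Function.Injective planeToRP2 := fun z w h => by
  have := ofComplex_injective (a₁ := ⟨z.1, z.2⟩) (a₂ := ⟨w.1, w.2⟩) h
  exact Prod.ext (congrArg Complex.re this) (congrArg Complex.im this)

theorem existsUnique_mem_line {s p s' p' : ℝ} (h : (s, p) ≠ (s', p')) :
    ∃! q, q ∈ line s p ∧ q ∈ line s' p' := by
  have hv : (![p - p', s' * p - s * p', s - s'] : Fin 3 → ℝ) ≠ 0 := by
    intro h0
    have h1 : p - p' = 0 := congrFun h0 0
    have h2 : s - s' = 0 := congrFun h0 2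
    exact h (Prod.ext (sub_eq_zero.1 h2) (sub_eq_zero.1 h1))
  refine ⟨mk ⟨_, hv⟩, ⟨mk_mem_line.2 ?_, mk_mem_line.2 ?_⟩, ?_⟩
  · simp; ring
  · simp; ring
  · rintro q ⟨hq, hq'⟩
    obtain ⟨w, rfl⟩ := exists_mk q
    rw [mk_mem_line] at hq hq'
    have hw : w.1 0 * (s - s') = w.1 2 * (p - p') := by linear_combination hq' - hq
    refine (mk_eq_mk.2 ?_).symm
    have hne : w.1 0 ≠ 0 ∨ w.1 2 ≠ 0 := by
      by_contra! h0
      refine w.2 (funext fun i => ?_)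
      fin_cases i
      · exact h0.1
      · change w.1 1 = 0
        rw [hq, h0.1, h0.2]; ring
      · exact h0.2
    by_cases hs : s - s' = 0
    · have hp : p - p' ≠ 0 := fun hp => h (Prod.ext (sub_eq_zero.1 hs) (sub_eq_zero.1 hp))
      have h2 : w.1 2 = 0 := by simpa [hs, hp] using hw.symm
      have h0 : w.1 0 ≠ 0 := hne.resolve_right (fun h => h h2)
      refine ⟨w.1 0 / (p - p'), div_ne_zero h0 hp, funext fun i => ?_⟩
      have hs' := sub_eq_zero.1 hs
      fin_cases i
      · simp; field_simp
      · simp [hq, h2, ← hs']; field_simp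
      · simp [h2, hs]
    · have h2 : w.1 2 ≠ 0 := by
        rintro h2
        rw [h2, zero_mul] at hw
        exact hne.elim (fun h => h ((mul_eq_zero.1 hw).resolve_right hs)) fun h => h h2
      have h0 : w.1 0 = w.1 2 * (p - p') / (s - s') := by rw [← hw]; field_simp
      refine ⟨w.1 2 / (s - s'), div_ne_zero h2 hs, funext fun i => ?_⟩
      fin_cases i
      · simp [h0]; field_simp
      · simp [hq, h0]; field_simp; ring
      · simp; field_simp

theorem isConnected_compl_line (s p : ℝ) : IsConnected (line s p)ᶜ := by
  have hv : ∀ z : ℝ × ℝ, (![z.1, 1 + s * z.1 - p * z.2, z.2] : Fin 3 → ℝ) ≠ 0 := by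
    intro z h
    have h0 : z.1 = 0 := congrFun h 0
    have h1 : 1 + s * z.1 - p * z.2 = 0 := congrFun h 1
    have h2 : z.2 = 0 := congrFun h 2
    simp [h0, h2] at h1
  have hr : range (fun z : ℝ × ℝ => mk ⟨_, hv z⟩) = (line s p)ᶜ := by
    ext q
    constructor
    · rintro ⟨z, rfl⟩
      rw [mem_compl_iff, mk_mem_line]
      simp only [Matrix.cons_val]
      intro h
      linarith
    · intro hq
      obtain ⟨v, rfl⟩ := exists_mk q
      rw [mem_compl_iff, mk_mem_line, ← sub_eq_zero] at hq
      set c := v.1 1 - (s * v.1 0 - p * v.1 2) with hc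
      refine ⟨(v.1 0 / c, v.1 2 / c), mk_eq_mk.2 ⟨c, hq, funext fun i => ?_⟩⟩
      fin_cases i
      · simp; field_simp
      · simp; field_simp; rw [hc]; ring
      · simp; field_simp
  rw [← hr]
  refine isConnected_range (continuous_mk.comp (Continuous.subtype_mk ?_ _))
  refine continuous_pi fun i => ?_
  fin_cases i <;> simp <;> fun_prop

theorem isPseudoline_line (s p : ℝ) : IsPseudoline (line s p) := by
  let u : ℝ → Fin 3 → ℝ := fun t =>
    ![Real.cos (Real.pi * t), s * Real.cos (Real.pi * t) - p * Real.sin (Real.pi * t),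
      Real.sin (Real.pi * t)]
  have hu : ∀ t, u t ≠ 0 := by
    intro t h
    have h0 : Real.cos (Real.pi * t) = 0 := congrFun h 0
    have h2 : Real.sin (Real.pi * t) = 0 := congrFun h 2
    have := Real.sin_sq_add_cos_sq (Real.pi * t)
    simp [h0, h2] at this
  let g : ℝ → RP2 := fun t => mk ⟨u t, hu t⟩
  have hg : Continuous g := by
    refine continuous_mk.comp (Continuous.subtype_mk (continuous_pi fun i => ?_) _)
    fin_cases i <;> simp [u] <;> fun_prop
  have hper : Function.Periodic g 1 := by
    intro t
    refine mk_eq_mk.2 ⟨-1, by norm_num, funext fun i => ?_⟩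
    fin_cases i <;> simp [u, mul_add, Real.cos_add_pi, Real.sin_add_pi]
    ring
  refine ⟨hper.lift, continuous_coinduced_dom.2 hg, ?_, ?_, isConnected_compl_line s p⟩
  · intro x y
    induction x using QuotientAddGroup.induction_on with | H a =>
    induction y using QuotientAddGroup.induction_on with | H b =>
    intro h
    obtain ⟨c, -, h⟩ := mk_eq_mk.1 (show g a = g b from h)
    have h0 : c * Real.cos (Real.pi * a) = Real.cos (Real.pi * b) := congrFun h 0
    have h2 : c * Real.sin (Real.pi * a) = Real.sin (Real.pi * b) := congrFun h 2
    have hs : Real.sin (Real.pi * b - Real.pi * a) = 0 := by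
      rw [Real.sin_sub, ← h0, ← h2]; ring
    obtain ⟨n, hn⟩ := Real.sin_eq_zero_iff.1 hs
    refine QuotientAddGroup.eq.2 (AddSubgroup.mem_zmultiples_iff.2 ⟨n, ?_⟩)
    rw [zsmul_eq_mul, mul_one]
    have := Real.pi_ne_zero
    refine mul_right_cancel₀ this ?_
    linear_combination hn
  · ext q
    constructor
    · rintro ⟨x, rfl⟩
      induction x using QuotientAddGroup.induction_on with | H a =>
      exact mk_mem_line.2 rfl
    · intro hq
      obtain ⟨v, rfl⟩ := exists_mk q
      rw [mk_mem_line] at hq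
      let z : ℂ := ⟨v.1 0, v.1 2⟩
      have hz : z ≠ 0 := by
        intro h
        have h0 : v.1 0 = 0 := congrArg Complex.re h
        have h2 : v.1 2 = 0 := congrArg Complex.im h
        refine v.2 (funext fun i => ?_)
        fin_cases i
        · exact h0
        · change v.1 1 = 0
          rw [hq, h0, h2]; ring
        · exact h2
      refine ⟨((z.arg / Real.pi : ℝ) : AddCircle (1 : ℝ)),
        mk_eq_mk.2 ⟨‖z‖, norm_ne_zero_iff.2 hz, ?_⟩⟩
      have hpi : Real.pi * (z.arg / Real.pi) = z.arg := by field_simp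
      have h0 : ‖z‖ * Real.cos z.arg = v.1 0 := by rw [Complex.norm_mul_cos_arg]
      have h2 : ‖z‖ * Real.sin z.arg = v.1 2 := by rw [Complex.norm_mul_sin_arg]
      funext i
      fin_cases i
      · simp [u, hpi, h0]
      · simp [u, hpi]
        linear_combination s * h0 - p * h2 - hq
      · simp [u, hpi, h2]

end RP2

/-- Every finite graph has a pseudolinear drawing with finitely many crossings. -/
theorem exists_isPseudolinear {n : ℕ} (G : SimpleGraph (Fin n)) :
    ∃ D : Drawing G, D.IsPseudolinear ∧ D.CrossSet.Finite := by
  let P : Fin n → Plane := fun i => ((i : ℝ), (i : ℝ) ^ 2)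
  have hends : ∀ e : G.edgeSet, ∃ x y, (e : Sym2 (Fin n)) = s(x, y) ∧ x < y := by
    rintro ⟨e, he⟩
    induction e using Sym2.ind with | _ x y =>
    rcases lt_or_gt_of_ne (SimpleGraph.Adj.ne he) with h | h
    · exact ⟨x, y, rfl, h⟩
    · exact ⟨y, x, Sym2.eq_swap, h⟩
  choose a b hab hlt using hends
  have hlt' : ∀ e, (a e : ℝ) < b e := fun e => by exact_mod_cast hlt e
  let A : G.edgeSet → ℝ → Plane := fun e t => ((a e : ℝ) + t * (b e - a e),
    ((a e : ℝ) + b e) * (a e + t * (b e - a e)) - a e * b e)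
  let D : Drawing G :=
    { vert := P
      vert_inj := fun i j h => by
        have : (i : ℝ) = j := congrArg Prod.fst h
        exact Fin.ext (by exact_mod_cast this)
      arc := A
      arc_cont := fun e => by
        refine Continuous.continuousOn ?_
        simp only [A]
        fun_prop
      arc_injOn := fun e t _ t' _ h => by
        have h1 : (a e : ℝ) + t * (b e - a e) = a e + t' * (b e - a e) := congrArg Prod.fst h
        have := (sub_pos.2 (hlt' e)).ne'
        exact mul_right_cancel₀ this (by linarith)
      arc_ends := fun e => ⟨a e, b e, hab e, by simp only [A, P]; ext <;> simp; ring,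
        by simp only [A, P]; ext <;> simp; ring⟩
      arc_avoid := by
        rintro e t - ⟨v, hv⟩
        have h1 : (a e : ℝ) + t * (b e - a e) = v := congrArg Prod.fst hv
        have h2 : ((a e : ℝ) + b e) * (a e + t * (b e - a e)) - a e * b e = (v : ℝ) ^ 2 :=
          congrArg Prod.snd hv
        have h3 := (sub_pos.2 (hlt' e)).ne'
        have h4 : t * (t - 1) = 0 := by
          refine mul_right_cancel₀ (pow_ne_zero 2 h3) ?_
          rw [h1] at h2
          have h5 : t * (b e - a e) = (v : ℝ) - a e := by linarith
          have h6 : (t - 1) * (b e - a e) = (v : ℝ) - b e := by linarith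
          linear_combination -h2 + (t - 1) * (b e - a e) * h5 + (v - a e) * h6
        rcases mul_eq_zero.1 h4 with h | h
        · exact .inl h
        · exact .inr (by linarith) }
  let L : G.edgeSet → Set RP2 := fun e => RP2.line (a e + b e) (a e * b e)
  have hL : ∀ e, ∀ t, planeToRP2 (D.arc e t) ∈ L e := fun e t =>
    RP2.planeToRP2_mem_line.2 rfl
  have hU : ∀ e f, e ≠ f → ∃! p, p ∈ L e ∧ p ∈ L f := by
    intro e f hef
    refine RP2.existsUnique_mem_line fun h => hef ?_
    have h1 : (a e : ℝ) + b e = a f + b f := congrArg Prod.fst h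
    have h2 : (a e : ℝ) * b e = a f * b f := congrArg Prod.snd h
    have h3 : ((a e : ℝ) - a f) * (a e - b f) = 0 := by linear_combination (a e : ℝ) * h1 - h2
    have h4 : (a e : ℝ) = a f := by
      rcases mul_eq_zero.1 h3 with h | h
      · linarith
      · have := hlt' e; have := hlt' f; linarith
    have h5 : (b e : ℝ) = b f := by linarith
    refine Subtype.ext ?_
    rw [hab, hab, Fin.ext (show (a e : ℕ) = a f by exact_mod_cast h4),
      Fin.ext (show (b e : ℕ) = b f by exact_mod_cast h5)]
  refine ⟨D, ⟨L, fun e => RP2.isPseudoline_line _ _, fun e t _ => hL e t, hU⟩, ?_⟩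
  refine Finite.of_injOn (t := univ) (f := Prod.snd) (fun _ _ => mem_univ _) ?_ finite_univ
  rintro ⟨z, p⟩ ⟨e, f, hef, rfl, ⟨t, -, rfl⟩, ⟨t', -, ht'⟩⟩
    ⟨z', p'⟩ ⟨e', f', hef', h', ⟨r, -, rfl⟩, ⟨r', -, hr'⟩⟩ h
  dsimp only at h h' ht' hr'
  subst h'
  refine Prod.ext (RP2.planeToRP2_injective ((hU e f hef).unique ⟨hL e t, ht' ▸ hL f t'⟩ ?_)) h
  rcases Sym2.eq_iff.1 h with ⟨rfl, rfl⟩ | ⟨rfl, rfl⟩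
  · exact ⟨hL _ r, hr' ▸ hL _ r'⟩
  · exact ⟨hr' ▸ hL _ r', hL _ r⟩

namespace Drawing

variable {V : Type*} {G : SimpleGraph V} (D : Drawing G)

theorem mem_of_vert_mem {e : G.edgeSet} {w : V} (h : D.vert w ∈ D.arc e '' Icc 0 1) :
    w ∈ (e : Sym2 V) := by
  obtain ⟨t, ht, htw⟩ := h
  obtain ⟨x, y, he, h0, h1⟩ := D.arc_ends e
  rw [he, Sym2.mem_iff]
  rcases D.arc_avoid e t ht ⟨w, htw⟩ with rfl | rfl
  · exact .inl (D.vert_inj (htw.symm.trans h0))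
  · exact .inr (D.vert_inj (htw.symm.trans h1))

theorem eq_vert_or_mem_interOf {e : G.edgeSet} {z : Plane} (h : z ∈ D.arc e '' Icc 0 1) :
    (∃ w, D.vert w = z) ∨ z ∈ D.interOf e := by
  obtain ⟨t, ht, rfl⟩ := h
  obtain ⟨x, y, -, h0, h1⟩ := D.arc_ends e
  rcases ht.1.eq_or_lt with rfl | h
  · exact .inl ⟨x, h0.symm⟩
  rcases ht.2.eq_or_lt with rfl | h'
  · exact .inl ⟨y, h1.symm⟩
  exact .inr ⟨t, ⟨h, h'⟩, rfl⟩

theorem eq_vert_or_mem_crossSet {e f : G.edgeSet} (hne : e ≠ f) {z : Plane}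
    (he : z ∈ D.arc e '' Icc 0 1) (hf : z ∈ D.arc f '' Icc 0 1) :
    (∃ w, D.vert w = z) ∨ (z, s(e, f)) ∈ D.CrossSet := by
  rcases D.eq_vert_or_mem_interOf he with h | h
  · exact .inl h
  rcases D.eq_vert_or_mem_interOf hf with h' | h'
  · exact .inl h'
  exact .inr ⟨e, f, hne, rfl, h, h'⟩

/-- The image of a vertex of a drawing in the complex plane. -/
def cvert (w : V) : ℂ := Complex.equivRealProdCLM.symm (D.vert w)

/-- The image of an edge of a drawing in the complex plane. -/
def carc (e : G.edgeSet) : Set ℂ := Complex.equivRealProdCLM.symm '' (D.arc e '' Icc 0 1)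

theorem cvert_injective : Function.Injective D.cvert :=
  Complex.equivRealProdCLM.symm.injective.comp D.vert_inj

theorem mem_of_cvert_mem {e : G.edgeSet} {w : V} (h : D.cvert w ∈ D.carc e) :
    w ∈ (e : Sym2 V) :=
  D.mem_of_vert_mem (Complex.equivRealProdCLM.symm.injective.mem_set_image.1 h)

theorem exists_cvert_eq {e f : G.edgeSet} (hne : e ≠ f) (h : ∀ x ∈ D.CrossSet, e ∉ x.2) {z : ℂ}
    (he : z ∈ D.carc e) (hf : z ∈ D.carc f) :
    ∃ w, D.cvert w = z ∧ w ∈ (e : Sym2 V) ∧ w ∈ (f : Sym2 V) := by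
  obtain ⟨p, hp, rfl⟩ := he
  have hp' := Complex.equivRealProdCLM.symm.injective.mem_set_image.1 hf
  rcases D.eq_vert_or_mem_crossSet hne hp hp' with ⟨w, rfl⟩ | h'
  · exact ⟨w, rfl, D.mem_of_vert_mem hp, D.mem_of_vert_mem hp'⟩
  · exact absurd (Sym2.mem_mk_left e f) (h _ h')

theorem exists_path {e : G.edgeSet} {a b : V} (h : (e : Sym2 V) = s(a, b)) :
    ∃ p : Path (D.cvert a) (D.cvert b), Function.Injective p ∧ range p = D.carc e := by
  obtain ⟨x, y, he, h0, h1⟩ := D.arc_ends e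
  let p : Path (D.cvert x) (D.cvert y) :=
    { toFun := fun t => Complex.equivRealProdCLM.symm (D.arc e t)
      continuous_toFun := Complex.equivRealProdCLM.symm.continuous.comp
        (continuousOn_iff_continuous_domRestrict.1 (D.arc_cont e))
      source' := congrArg Complex.equivRealProdCLM.symm h0
      target' := congrArg Complex.equivRealProdCLM.symm h1 }
  have hp : Function.Injective p := fun s t hst =>
    Subtype.ext (D.arc_injOn e s.2 t.2 (Complex.equivRealProdCLM.symm.injective hst))
  have hr : range p = D.carc e := by
    rw [carc, image_image, image_eq_range]
    rfl
  rcases Sym2.eq_iff.1 (he.symm.trans h) with ⟨rfl, rfl⟩ | ⟨rfl, rfl⟩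
  · exact ⟨p, hp, hr⟩
  · exact ⟨p.symm, hp.comp unitInterval.symm_bijective.injective, by rw [Path.symm_range, hr]⟩

theorem exists_uncrossed (hfin : D.CrossSet.Finite) {N : ℕ} {f : Fin N → Bool → G.edgeSet}
    (hf : ∀ i j s t, f i s = f j t → i = j) (h : 2 * D.CrossSet.ncard < N) :
    ∃ i, ∀ s, ∀ x ∈ D.CrossSet, f i s ∉ x.2 := by
  by_contra! hcon
  choose s x hx hmem using hcon
  classical
  have hcard := Finset.card_le_mul_card_image_of_maps_to (s := Finset.univ) (f := x)
    (t := hfin.toFinset) (fun i _ => hfin.mem_toFinset.2 (hx i)) 2 fun y _ => by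
      have : (Finset.univ.filter fun i => x i = y).image (fun i => f i (s i)) ⊆ y.2.toFinset := by
        intro e he
        obtain ⟨i, hi, rfl⟩ := Finset.mem_image.1 he
        rw [Sym2.mem_toFinset, ← (Finset.mem_filter.1 hi).2]
        exact hmem i
      rw [← Finset.card_image_of_injective _ fun i j hij => hf i j _ _ hij]
      refine (Finset.card_le_card this).trans ?_
      rw [Sym2.card_toFinset]
      split_ifs <;> omega
  rw [Finset.card_fin, ← Set.ncard_eq_toFinset_card _ hfin] at hcard
  omega

end Drawing

theorem coreEnds_injective : Function.Injective coreEnds := by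
  unfold Function.Injective
  decide +kernel

theorem exists_of_mem_coreT : ∀ e ∈ coreT, ∃ k, coreEnds (thickK k) = e := by decide +kernel

theorem exists_of_mem_coreS : ∀ e ∈ coreS, ∃ j, coreEnds (thinK j) = e := by decide +kernel

theorem thickK_ne_thinK (k : Fin 28) (j : Fin 10) : thickK k ≠ thinK j := fun h => by
  have := congrArg Fin.val h
  simp only [thickK, thinK, Fin.val_castLE, Fin.val_natAdd] at this
  omega

theorem exists_of_mem_core {e : Fin 18 × Fin 18} (h : e ∈ coreT ++ coreS) :
    ∃ k, coreEnds (Sum.elim thickK thinK k) = e := by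
  rcases List.mem_append.1 h with h | h
  · obtain ⟨k, hk⟩ := exists_of_mem_coreT e h
    exact ⟨.inl k, hk⟩
  · obtain ⟨j, hj⟩ := exists_of_mem_coreS e h
    exact ⟨.inr j, hj⟩

theorem core_injective :
    Function.Injective fun k => coreEnds (Sum.elim thickK thinK k) :=
  coreEnds_injective.comp
    (Function.Injective.sumElim Thick.thickK_injective Thick.thinK_injective thickK_ne_thinK)

/-- The edges that form a chosen copy of an edge of the core graph. -/
def copyEdge {N : ℕ} (c : Fin 28 → Fin N) : Fin 28 ⊕ Fin 10 → Bool → ThickE N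
  | .inl k, s => .inl ((k, c k), s)
  | .inr j, _ => .inr j

theorem Drawing.card_le_ncard_crossSet {N : ℕ} {W : Type*} {φ : ThickV N → W}
    (hφ : Function.Injective φ) {D : Drawing (thickGraph φ)} (hD : D.IsPseudolinear)
    (hfin : D.CrossSet.Finite) : N ≤ 2 * D.CrossSet.ncard := by
  by_contra! hlt
  obtain ⟨L, hL, hmem, hint⟩ := hD
  let E : ThickE N ≃ (thickGraph φ).edgeSet :=
    edgeEquiv (thickEnds_injective hφ) (thickEnds_ne hφ)
  have hE : ∀ i, (E i : Sym2 W) = s(φ (thickEnds N i).1, φ (thickEnds N i).2) := fun i => rfl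
  have hpick : ∀ k, ∃ i, ∀ s, ∀ x ∈ D.CrossSet, E (.inl ((k, i), s)) ∉ x.2 := fun k =>
    D.exists_uncrossed hfin (f := fun i s => E (.inl ((k, i), s)))
      (fun i j s t h =>
        (Prod.ext_iff.1 (Prod.ext_iff.1 (Sum.inl_injective (E.injective h))).1).2) hlt
  choose c hc using hpick
  let F : Fin 28 ⊕ Fin 10 → Bool → (thickGraph φ).edgeSet := fun k s => E (copyEdge c k s)
  have hF_ne : ∀ k k' s s', k ≠ k' → F k s ≠ F k' s' := by
    rintro (k | j) (k' | j') s s' hne h <;> have h := E.injective h <;>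
      simp only [copyEdge, Sum.inl.injEq, Sum.inr.injEq, Prod.mk.injEq, reduceCtorEq] at h
    · exact hne (congrArg _ h.1.1)
    · exact hne (congrArg _ h)
  have hF_mem : ∀ k s w, w ∈ (F k s : Sym2 W) →
      w = φ (.inl (coreEnds (Sum.elim thickK thinK k)).1) ∨
      w = φ (.inl (coreEnds (Sum.elim thickK thinK k)).2) ∨
      ∃ j, k = .inl j ∧ w = φ (.inr (j, c j)) := by
    rintro (k | j) s w hw
    · rcases Sym2.mem_iff.1 ((hE _) ▸ hw) with rfl | rfl
      · cases s
        · exact .inl rfl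
        · exact .inr (.inl rfl)
      · exact .inr (.inr ⟨k, rfl, rfl⟩)
    · rcases Sym2.mem_iff.1 ((hE _) ▸ hw) with rfl | rfl
      · exact .inl rfl
      · exact .inr (.inl rfl)
  let pos : Fin 18 → ℂ := fun v => D.cvert (φ (.inl v))
  have hpath : ∀ k, ∃ p : Path (pos (coreEnds (Sum.elim thickK thinK k)).1)
      (pos (coreEnds (Sum.elim thickK thinK k)).2),
      range p = D.carc (F k false) ∪ D.carc (F k true) ∧
        ∀ j, k = .inr j → Function.Injective p := by
    rintro (k | j)
    · obtain ⟨p, -, hp⟩ := D.exists_path (hE (.inl ((k, c k), false)))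
      obtain ⟨q, -, hq⟩ := D.exists_path (hE (.inl ((k, c k), true)))
      refine ⟨p.trans q.symm, (Path.trans_range p q.symm).trans ?_, by simp⟩
      exact congrArg₂ _ hp ((Path.symm_range q).trans hq)
    · obtain ⟨p, hi, hp⟩ := D.exists_path (hE (.inr j))
      exact ⟨p, hp.trans (union_self _).symm, fun _ _ => hi⟩
  have harc : ∀ u v, ∃ p : Path (pos u) (pos v), ∀ k,
      coreEnds (Sum.elim thickK thinK k) = (u, v) →
      range p = D.carc (F k false) ∪ D.carc (F k true) ∧
        ∀ j, k = .inr j → Function.Injective p := by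
    intro u v
    by_cases h : ∃ k, coreEnds (Sum.elim thickK thinK k) = (u, v)
    · obtain ⟨k, hk⟩ := h
      obtain ⟨rfl, rfl⟩ := Prod.ext_iff.1 hk
      obtain ⟨p, hp⟩ := hpath k
      refine ⟨p, fun k' hk' => ?_⟩
      obtain rfl := core_injective (hk'.trans hk.symm)
      exact hp
    · exact ⟨PathConnectedSpace.somePath _ _, fun k hk => absurd ⟨k, hk⟩ h⟩
  have hline : ∀ u v, ∃ ℓ : Set RP2, ∀ j, coreEnds (thinK j) = (u, v) → ℓ = L (E (.inr j)) := by
    intro u v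
    by_cases h : ∃ j, coreEnds (thinK j) = (u, v)
    · obtain ⟨j, hj⟩ := h
      refine ⟨L (E (.inr j)), fun j' hj' => ?_⟩
      rw [Thick.thinK_injective (coreEnds_injective (hj'.trans hj.symm))]
    · exact ⟨∅, fun j hj => absurd ⟨j, hj⟩ h⟩
  choose arc harc using harc
  choose line hline using hline
  have hrange : ∀ {u v k z}, coreEnds (Sum.elim thickK thinK k) = (u, v) → z ∈ range (arc u v) →
      ∃ s, z ∈ D.carc (F k s) := by
    intro u v k z hk hz
    rw [(harc u v k hk).1] at hz
    exact hz.elim (fun h => ⟨_, h⟩) fun h => ⟨_, h⟩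
  refine Config.isEmpty_core.false
    { pos := pos
      pos_inj := D.cvert_injective.comp (hφ.comp Sum.inl_injective)
      arc := arc
      avoid := ?_
      thick := ?_
      line := line
      arc_inj := ?_
      isPseudoline := ?_
      arc_mem_line := ?_
      line_inter := ?_ }
  · intro u v huv w hw
    obtain ⟨k, hk⟩ := exists_of_mem_core huv
    obtain ⟨s, hs⟩ := hrange hk hw
    rcases hF_mem k s _ (D.mem_of_cvert_mem hs) with h | h | ⟨j, -, h⟩
    · exact .inl (by simpa [hk] using hφ h)
    · exact .inr (by simpa [hk] using hφ h)
    · exact absurd (hφ h) Sum.inl_ne_inr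
  · intro u v huv u' v' huv' hne z hz hz'
    obtain ⟨k, hk⟩ := exists_of_mem_coreT _ huv
    obtain ⟨k', hk'⟩ := exists_of_mem_core huv'
    have hkk : Sum.inl k ≠ k' := by
      rintro rfl
      exact hne (hk.symm.trans hk')
    obtain ⟨s, hs⟩ := hrange (k := .inl k) hk hz
    obtain ⟨s', hs'⟩ := hrange hk' hz'
    obtain ⟨w, rfl, hw, hw'⟩ := D.exists_cvert_eq (hF_ne _ _ _ _ hkk) (hc k s) hs hs'
    rcases hF_mem _ _ _ hw with rfl | rfl | ⟨j, hj, rfl⟩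
    · exact ⟨_, rfl⟩
    · exact ⟨_, rfl⟩
    · rcases hF_mem _ _ _ hw' with h | h | ⟨j', rfl, h⟩
      · exact absurd (hφ h).symm Sum.inl_ne_inr
      · exact absurd (hφ h).symm Sum.inl_ne_inr
      · have := Sum.inr_injective (hφ h)
        exact absurd (hj.trans (congrArg _ (Prod.ext_iff.1 this).1)) hkk
  · intro u v huv
    obtain ⟨j, hj⟩ := exists_of_mem_coreS _ huv
    exact (harc u v (.inr j) hj).2 j rfl
  · intro u v huv
    obtain ⟨j, hj⟩ := exists_of_mem_coreS _ huv
    rw [hline u v j hj]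
    exact hL _
  · intro u v huv z hz
    obtain ⟨j, hj⟩ := exists_of_mem_coreS _ huv
    rw [hline u v j hj]
    obtain ⟨-, _, ⟨t, ht, rfl⟩, rfl⟩ := hrange (k := .inr j) hj hz
    exact hmem _ t ht
  · intro u v huv u' v' huv' hne p hp hp' q hq hq'
    obtain ⟨j, hj⟩ := exists_of_mem_coreS _ huv
    obtain ⟨j', hj'⟩ := exists_of_mem_coreS _ huv'
    rw [hline u v j hj] at hp hq
    rw [hline u' v' j' hj'] at hp' hq'
    refine (hint _ _ (E.injective.ne fun h => hne ?_)).unique ⟨hp, hp'⟩ ⟨hq, hq'⟩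
    rw [← hj, ← hj', Sum.inr_injective h]

/-- Theorem. For all integers `k` and `m` with `m ≥ k ≥ 4`, there exists a finite
simple graph `G` such that `mon-cr G ≤ C(2k, 2)` and `pcr G ≥ m`. -/
theorem exists_graph_moncrNum_le_and_pcrNum_ge (k m : ℕ) (hk : 4 ≤ k) (hm : k ≤ m) :
    ∃ (n : ℕ) (G : SimpleGraph (Fin n)),
      moncrNum G ≤ (2 * k).choose 2 ∧ m ≤ pcrNum G := by
  let φ := Fintype.equivFin (ThickV (2 * m))
  refine ⟨_, thickGraph φ, ?_, ?_⟩
  · have h : moncrNum (thickGraph φ) ≤ (Thick.drawing φ).CrossSet.ncard :=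
      Nat.sInf_le ⟨_, Thick.drawing_isMonotone φ, (Thick.drawing_crossSet φ).1, rfl⟩
    refine (h.trans (Thick.drawing_crossSet φ).2).trans ?_
    exact (by decide : 4 ≤ Nat.choose 8 2).trans (Nat.choose_le_choose 2 (by omega))
  · obtain ⟨D, hD, hfin⟩ := exists_isPseudolinear (thickGraph φ)
    refine le_csInf ⟨_, D, hD, hfin, rfl⟩ ?_
    rintro _ ⟨D, hD, hfin, rfl⟩
    have := D.card_le_ncard_crossSet φ.injective hD hfin
    omega

end
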